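/- arXiv:1006.5140 — 7 statements merged into one kernel-verified Lean document; each statement's English description precedes it below -/
import Mathlib

section
/- Let n ≥ 2 be an integer and let λ be a real number with 1/2 ≤ λ ≤ 1. Let S : [0,∞) → [0,∞) be a continuous increasing function such that ∫₀¹ S(t·x)(1−x²)^{n−2} x dx ≤ t^λ for all t ∈ [0,∞). Then ∫₀^∞ S(t)·t^{2λ−1}/(1+t^{2λ})² dt ≤ (π(n−1)/(2λ))·∏_{k=1}^{n−1} (1 + λ/(2k)). -/
open MeasureTheory Set Filter Topology

/-- `g` is nonnegative on `(0, ∞)` and so are its first `k` derivatives with alternating signs. -/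
def CompletelyMonotoneUpTo : ℕ → (ℝ → ℝ) → Prop
  | 0, g => ∀ v > 0, 0 ≤ g v
  | k + 1, g => (∀ v > 0, 0 ≤ g v) ∧
      ∃ h : ℝ → ℝ, (∀ v > 0, HasDerivAt g (-h v) v) ∧ CompletelyMonotoneUpTo k h

namespace CompletelyMonotoneUpTo

theorem nonneg {k : ℕ} {g : ℝ → ℝ} (hg : CompletelyMonotoneUpTo k g) : ∀ v > 0, 0 ≤ g v := by
  cases k with
  | zero => exact hg
  | succ k => exact hg.1

theorem of_succ {k : ℕ} {g : ℝ → ℝ} (hg : CompletelyMonotoneUpTo (k + 1) g) :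
    CompletelyMonotoneUpTo k g := by
  induction k generalizing g with
  | zero => exact hg.1
  | succ k ih =>
    obtain ⟨h0, h, hd, hh⟩ := hg
    exact ⟨h0, h, hd, ih hh⟩

theorem add {k : ℕ} {f g : ℝ → ℝ} (hf : CompletelyMonotoneUpTo k f)
    (hg : CompletelyMonotoneUpTo k g) : CompletelyMonotoneUpTo k (fun v => f v + g v) := by
  induction k generalizing f g with
  | zero => exact fun v hv => add_nonneg (hf v hv) (hg v hv)
  | succ k ih =>
    obtain ⟨hf0, f', hfd, hf'⟩ := hf
    obtain ⟨hg0, g', hgd, hg'⟩ := hg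
    refine ⟨fun v hv => add_nonneg (hf0 v hv) (hg0 v hv), _, fun v hv => ?_, ih hf' hg'⟩
    exact ((hfd v hv).add (hgd v hv)).congr_deriv (by ring)

theorem mul {k : ℕ} {f g : ℝ → ℝ} (hf : CompletelyMonotoneUpTo k f)
    (hg : CompletelyMonotoneUpTo k g) : CompletelyMonotoneUpTo k (fun v => f v * g v) := by
  induction k generalizing f g with
  | zero => exact fun v hv => mul_nonneg (hf v hv) (hg v hv)
  | succ k ih =>
    have hfk := hf.of_succ
    have hgk := hg.of_succ
    obtain ⟨hf0, f', hfd, hf'⟩ := hf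
    obtain ⟨hg0, g', hgd, hg'⟩ := hg
    refine ⟨fun v hv => mul_nonneg (hf0 v hv) (hg0 v hv), _, fun v hv => ?_,
      (ih hf' hgk).add (ih hfk hg')⟩
    exact ((hfd v hv).mul (hgd v hv)).congr_deriv (by ring)

theorem const_mul_rpow (k : ℕ) {c a : ℝ} (hc : 0 ≤ c) (ha : a ≤ 0) :
    CompletelyMonotoneUpTo k (fun v => c * v ^ a) := by
  induction k generalizing c a with
  | zero => exact fun v hv => mul_nonneg hc (Real.rpow_nonneg hv.le _)
  | succ k ih =>
    refine ⟨fun v hv => mul_nonneg hc (Real.rpow_nonneg hv.le _), _, fun v hv => ?_,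
      ih (c := c * (-a)) (a := a - 1) (mul_nonneg hc (by linarith)) (by linarith)⟩
    exact ((Real.hasDerivAt_rpow_const (Or.inl hv.ne')).const_mul c).congr_deriv (by ring)

theorem inv_one_add_rpow (k : ℕ) {a : ℝ} (ha0 : 0 ≤ a) (ha1 : a ≤ 1) :
    CompletelyMonotoneUpTo k (fun v => (1 + v ^ a)⁻¹) := by
  have h0 : ∀ v : ℝ, v > 0 → 0 < 1 + v ^ a := fun v hv => by
    have := Real.rpow_nonneg hv.le a
    linarith
  induction k with
  | zero => exact fun v hv => (inv_pos.2 (h0 v hv)).le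
  | succ k ih =>
    refine ⟨fun v hv => (inv_pos.2 (h0 v hv)).le, _, fun v hv => ?_,
      (const_mul_rpow k (c := a) (a := a - 1) ha0 (by linarith)).mul (ih.mul ih)⟩
    refine (((Real.hasDerivAt_rpow_const (p := a) (Or.inl hv.ne')).const_add 1).inv
      (h0 v hv).ne').congr_deriv ?_
    have := (h0 v hv).ne'
    field_simp

theorem antitoneOn {k : ℕ} {g : ℝ → ℝ} (hg : CompletelyMonotoneUpTo (k + 1) g) :
    AntitoneOn g (Ioi 0) := by
  obtain ⟨-, h, hd, hh⟩ := hg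
  refine antitoneOn_of_deriv_nonpos (convex_Ioi 0)
    (fun v hv => (hd v hv).continuousAt.continuousWithinAt) ?_ ?_
  · rw [interior_Ioi]
    exact fun v hv => (hd v hv).differentiableAt.differentiableWithinAt
  · rw [interior_Ioi]
    intro v hv
    rw [(hd v hv).deriv]
    linarith [hh.nonneg v hv]

end CompletelyMonotoneUpTo

theorem tendsto_zero_of_antitoneOn_of_hasDerivAt {g h : ℝ → ℝ} (hg : ∀ v > 0, 0 ≤ g v)
    (hh : ∀ v > 0, 0 ≤ h v) (hanti : AntitoneOn h (Ioi 0))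
    (hd : ∀ v > 0, HasDerivAt g (-h v) v) (hlim : Tendsto g atTop (𝓝 0)) :
    Tendsto h atTop (𝓝 0) := by
  have hlim' : Tendsto (fun v => g (v - 1)) atTop (𝓝 0) :=
    hlim.comp (tendsto_atTop_add_const_right _ (-1) tendsto_id)
  refine tendsto_of_tendsto_of_tendsto_of_le_of_le' tendsto_const_nhds hlim' ?_ ?_
  · filter_upwards [eventually_gt_atTop 0] with v hv using hh v hv
  · filter_upwards [eventually_gt_atTop 1] with v hv
    obtain ⟨c, hc, hceq⟩ := exists_hasDerivAt_eq_slope g (fun x => -h x) (by linarith : v - 1 < v)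
      (fun x hx => (hd x (by linarith [hx.1])).continuousAt.continuousWithinAt)
      (fun x hx => hd x (by linarith [hx.1]))
    have h1 := hanti (show c ∈ Ioi 0 from by simp; linarith [hc.1])
      (show v ∈ Ioi 0 from by simp; linarith) hc.2.le
    have h2 := hg v (by linarith)
    rw [show v - (v - 1) = 1 by ring, div_one] at hceq
    linarith

theorem lintegral_lintegral_Ioi_swap {K : ℝ → ℝ → ENNReal} (hK : Measurable (Function.uncurry K))
    {φ : ℝ → ℝ} (hφ : Measurable φ) (s : Set ℝ) :
    ∫⁻ y in s, ∫⁻ z in Ioi (φ y), K y z = ∫⁻ z, ∫⁻ y in s ∩ {y | φ y < z}, K y z := by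
  have hset : MeasurableSet {q : ℝ × ℝ | φ q.1 < q.2} :=
    measurableSet_lt (hφ.comp measurable_fst) measurable_snd
  have e1 : ∀ y, ∫⁻ z in Ioi (φ y), K y z =
      ∫⁻ z, {q : ℝ × ℝ | φ q.1 < q.2}.indicator (Function.uncurry K) (y, z) := fun y => by
    rw [← lintegral_indicator measurableSet_Ioi]
    rfl
  simp_rw [e1]
  rw [lintegral_lintegral_swap (f := fun y z =>
    {q : ℝ × ℝ | φ q.1 < q.2}.indicator (Function.uncurry K) (y, z))
    (hK.indicator hset).aemeasurable]
  refine lintegral_congr fun z => ?_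
  rw [inter_comm, ← Measure.restrict_restrict (measurableSet_lt hφ measurable_const),
    ← lintegral_indicator (measurableSet_lt hφ measurable_const)]
  rfl

theorem lintegral_Ioo_sub_pow (p : ℕ) {v z : ℝ} (hvz : v ≤ z) :
    ∫⁻ y in Ioo v z, ENNReal.ofReal ((z - y) ^ p) =
      ENNReal.ofReal ((z - v) ^ (p + 1) / (p + 1)) := by
  rw [restrict_Ioo_eq_restrict_Ioc, ← ofReal_integral_eq_lintegral_ofReal,
    ← intervalIntegral.integral_of_le hvz]
  · rw [intervalIntegral.integral_comp_sub_left (fun x => x ^ p) z, integral_pow]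
    simp
  · exact ((by fun_prop : Continuous fun y : ℝ => (z - y) ^ p).integrableOn_Icc).mono_set
      Ioc_subset_Icc_self
  · filter_upwards [ae_restrict_mem measurableSet_Ioc] with y hy
    exact pow_nonneg (by linarith [hy.2]) _

theorem ofReal_eq_lintegral_Ioi_of_hasDerivAt {g h : ℝ → ℝ} (hh : ∀ v > 0, 0 ≤ h v)
    (hd : ∀ v > 0, HasDerivAt g (-h v) v) (hlim : Tendsto g atTop (𝓝 0)) {v : ℝ} (hv : 0 < v) :
    ENNReal.ofReal (g v) = ∫⁻ y in Ioi v, ENNReal.ofReal (h y) := by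
  have hd' : ∀ x ∈ Ici v, HasDerivAt g (-h x) x := fun x hx => hd x (hv.trans_le hx)
  have hn : ∀ x ∈ Ioi v, -h x ≤ 0 := fun x hx => by linarith [hh x (hv.trans hx)]
  have h1 := integral_Ioi_of_hasDerivAt_of_nonpos' hd' hn hlim
  have h2 := (integrableOn_Ioi_deriv_of_nonpos' hd' hn hlim).neg
  rw [← ofReal_integral_eq_lintegral_ofReal (by simpa using! h2)]
  · rw [integral_neg] at h1
    congr 1
    linarith
  · filter_upwards [ae_restrict_mem measurableSet_Ioi] with y hy using hh y (hv.trans hy)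

theorem CompletelyMonotoneUpTo.exists_lintegral_repr {p : ℕ} {g : ℝ → ℝ}
    (hg : CompletelyMonotoneUpTo (p + 1) g) (hlim : Tendsto g atTop (𝓝 0)) :
    ∃ H : ℝ → ENNReal, Measurable H ∧ ∀ v > 0,
      ENNReal.ofReal (g v) = ∫⁻ y in Ioi v, ENNReal.ofReal ((y - v) ^ p) * H y := by
  induction p generalizing g with
  | zero =>
    obtain ⟨h0, h, hd, hh⟩ := hg
    refine ⟨fun y => ENNReal.ofReal (-deriv g y), (measurable_deriv g).neg.ennreal_ofReal,
      fun v hv => ?_⟩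
    rw [ofReal_eq_lintegral_Ioi_of_hasDerivAt hh hd hlim hv]
    refine setLIntegral_congr_fun measurableSet_Ioi fun y hy => ?_
    simp [(hd y (hv.trans hy)).deriv]
  | succ p ih =>
    obtain ⟨h0, h, hd, hh⟩ := hg
    obtain ⟨H, hH, hrep⟩ := ih hh
      (tendsto_zero_of_antitoneOn_of_hasDerivAt h0 hh.nonneg hh.antitoneOn hd hlim)
    refine ⟨fun z => ENNReal.ofReal (1 / (p + 1)) * H z, hH.const_mul _, fun v hv => ?_⟩
    rw [ofReal_eq_lintegral_Ioi_of_hasDerivAt hh.nonneg hd hlim hv,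
      setLIntegral_congr_fun measurableSet_Ioi fun y hy => hrep y (hv.trans hy),
      lintegral_lintegral_Ioi_swap (φ := fun y => y) (K := fun y z => ENNReal.ofReal ((z - y) ^ p) * H z)
        (by unfold Function.uncurry; fun_prop) (by fun_prop) (Ioi v),
      ← lintegral_indicator measurableSet_Ioi]
    refine lintegral_congr fun z => ?_
    change ∫⁻ y in Ioo v z, _ = _
    by_cases hz : v < z
    · rw [indicator_of_mem (show z ∈ Ioi v from hz),
        lintegral_mul_const _ (by fun_prop), lintegral_Ioo_sub_pow p hz.le, ← mul_assoc,
        ← ENNReal.ofReal_mul (pow_nonneg (by linarith) _), mul_one_div]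
    · rw [indicator_of_notMem (show z ∉ Ioi v from hz), Ioo_eq_empty hz]
      simp

theorem lintegral_Ioi_eq_lintegral_beta_transform {p : ℕ} {h : ℝ → ℝ} {H : ℝ → ENNReal}
    (hH : Measurable H)
    (hrep : ∀ v > 0, ENNReal.ofReal (h v) = ∫⁻ y in Ioi v, ENNReal.ofReal ((y - v) ^ p) * H y)
    {S : ℝ → ℝ} (hS : Continuous S) (hS0 : ∀ x, 0 ≤ x → 0 ≤ S x) :
    ∫⁻ s in Ioi (0 : ℝ), ENNReal.ofReal (S s * s * h (s ^ 2)) =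
      ∫⁻ y, (Ioi (0 : ℝ)).indicator (fun y => ENNReal.ofReal (y ^ (p + 1)) * H y) y *
        ENNReal.ofReal (∫ x in (0 : ℝ)..1, S (√y * x) * (1 - x ^ 2) ^ p * x) := by
  have e1 : ∀ s ∈ Ioi (0 : ℝ), ENNReal.ofReal (S s * s * h (s ^ 2)) =
      ∫⁻ y in Ioi (s ^ 2), ENNReal.ofReal (S s * s) * (ENNReal.ofReal ((y - s ^ 2) ^ p) * H y) :=
    fun s hs => by
    have hs' : 0 < s := hs
    rw [ENNReal.ofReal_mul (mul_nonneg (hS0 s hs'.le) hs'.le), hrep (s ^ 2) (by positivity),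
      lintegral_const_mul _ (by fun_prop)]
  rw [setLIntegral_congr_fun measurableSet_Ioi e1, lintegral_lintegral_Ioi_swap
    (K := fun s y => ENNReal.ofReal (S s * s) * (ENNReal.ofReal ((y - s ^ 2) ^ p) * H y))
    (by unfold Function.uncurry; fun_prop) (by fun_prop) (Ioi 0)]
  refine lintegral_congr fun y => ?_
  by_cases hy : 0 < y
  · have hset : Ioi 0 ∩ {s : ℝ | s ^ 2 < y} = Ioo 0 √y := by
      ext s
      simp only [mem_inter_iff, mem_Ioi, mem_ofPred_eq, mem_Ioo, and_congr_right_iff]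
      exact fun hs => (Real.lt_sqrt hs.le).symm
    have hsq := Real.sq_sqrt hy.le
    have hscale : ∫ s in (0 : ℝ)..√y, S s * s * (y - s ^ 2) ^ p =
        y ^ (p + 1) * ∫ x in (0 : ℝ)..1, S (√y * x) * (1 - x ^ 2) ^ p * x := by
      have := intervalIntegral.mul_integral_comp_mul_left (a := 0) (b := 1)
        (f := fun s => S s * s * (y - s ^ 2) ^ p) √y
      rw [mul_zero, mul_one] at this
      rw [← this, ← intervalIntegral.integral_const_mul, ← intervalIntegral.integral_const_mul]
      refine intervalIntegral.integral_congr fun x _ => ?_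
      rw [show y - (√y * x) ^ 2 = y * (1 - x ^ 2) by rw [mul_pow, hsq]; ring, mul_pow, pow_succ]
      linear_combination (S (√y * x) * x * y ^ p * (1 - x ^ 2) ^ p) * hsq
    rw [hset, indicator_of_mem (show y ∈ Ioi 0 from hy)]
    simp_rw [← mul_assoc]
    rw [lintegral_mul_const _ (by fun_prop), mul_right_comm,
      ← ENNReal.ofReal_mul (by positivity), ← hscale,
      intervalIntegral.integral_of_le (Real.sqrt_nonneg y), restrict_Ioo_eq_restrict_Ioc,
      ofReal_integral_eq_lintegral_ofReal]
    · congr 1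
      refine setLIntegral_congr_fun measurableSet_Ioc fun s hs => ?_
      exact (ENNReal.ofReal_mul (mul_nonneg (hS0 s hs.1.le) hs.1.le)).symm
    · exact ((by fun_prop : Continuous fun s : ℝ => S s * s * (y - s ^ 2) ^ p).integrableOn_Icc).mono_set
        Ioc_subset_Icc_self
    · filter_upwards [ae_restrict_mem measurableSet_Ioc] with s hs
      refine mul_nonneg (mul_nonneg (hS0 s hs.1.le) hs.1.le) (pow_nonneg ?_ _)
      nlinarith [hs.1, hs.2]
  · have hset : Ioi 0 ∩ {s : ℝ | s ^ 2 < y} = ∅ := by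
      ext s
      simp only [mem_inter_iff, mem_Ioi, mem_ofPred_eq, mem_empty_iff_false, iff_false, not_and]
      intro _ hs
      nlinarith [sq_nonneg s]
    rw [hset, indicator_of_notMem (show y ∉ Ioi 0 from hy)]
    simp

theorem integral_rpow_mul_one_sub_sq_pow {a : ℝ} (ha : 0 < a) (p : ℕ) :
    ∫ x in (0 : ℝ)..1, x ^ a * (1 - x ^ 2) ^ p * x =
      (2 * ((p : ℝ) + 1) * ∏ k ∈ Finset.Icc 1 (p + 1), (1 + a / (2 * (k : ℝ))))⁻¹ := by
  have hc : ∀ q : ℕ, Continuous fun x : ℝ => x ^ a * (1 - x ^ 2) ^ q * x := fun q =>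
    ((Real.continuous_rpow_const ha.le).mul (by fun_prop)).mul continuous_id
  have hd : ∀ x ∈ Ioo (0 : ℝ) 1, HasDerivAt (fun x : ℝ => x ^ a * x ^ 2)
      ((a + 2) * (x ^ a * x)) x := fun x hx => by
    refine ((Real.hasDerivAt_rpow_const (Or.inl hx.1.ne')).mul (hasDerivAt_pow 2 x)).congr_deriv ?_
    rw [Real.rpow_sub_one hx.1.ne']
    have := hx.1.ne'
    field_simp
    push_cast
    ring
  induction p with
  | zero =>
    have h := intervalIntegral.integral_eq_sub_of_hasDerivAt_of_le (zero_le_one' ℝ)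
      ((Real.continuous_rpow_const ha.le).mul (by fun_prop : Continuous fun x : ℝ => x ^ 2)).continuousOn
      hd ((((Real.continuous_rpow_const ha.le).mul continuous_id).const_mul (a + 2)).intervalIntegrable _ _)
    rw [intervalIntegral.integral_const_mul] at h
    simp only [pow_zero, mul_one]
    norm_num at h ⊢
    field_simp
    linarith
  | succ p ih =>
    have h := intervalIntegral.integral_eq_sub_of_hasDerivAt_of_le (zero_le_one' ℝ)
      (f := fun x : ℝ => x ^ a * x ^ 2 * (1 - x ^ 2) ^ (p + 1))
      (f' := fun x => (a + 2 + 2 * (p + 1)) * (x ^ a * (1 - x ^ 2) ^ (p + 1) * x) -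
        2 * (p + 1) * (x ^ a * (1 - x ^ 2) ^ p * x))
      (((Real.continuous_rpow_const ha.le).mul (by fun_prop)).mul (by fun_prop)).continuousOn
      (fun x hx => by
        refine ((hd x hx).mul (((hasDerivAt_pow 2 x).const_sub 1).pow (p + 1))).congr_deriv ?_
        push_cast
        simp only [Pi.pow_apply]
        ring)
      ((((hc (p + 1)).const_mul _).sub ((hc p).const_mul _)).intervalIntegrable _ _)
    rw [intervalIntegral.integral_sub (((hc (p + 1)).const_mul _).intervalIntegrable _ _)
      (((hc p).const_mul _).intervalIntegrable _ _), intervalIntegral.integral_const_mul,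
      intervalIntegral.integral_const_mul, ih] at h
    rw [Finset.prod_Icc_succ_top (by omega)]
    have hP : 0 < ∏ k ∈ Finset.Icc 1 (p + 1), (1 + a / (2 * (k : ℝ))) :=
      Finset.prod_pos fun k _ => by positivity
    set P := ∏ k ∈ Finset.Icc 1 (p + 1), (1 + a / (2 * (k : ℝ)))
    norm_num at h
    push_cast
    field_simp at h ⊢
    linarith

theorem lintegral_rpow_div_one_add_sq {a c : ℝ} (ha : 0 < a) (hc : 0 ≤ c) :
    ∫⁻ t in Ioi (0 : ℝ), ENNReal.ofReal (c * t ^ a * t * (1 * (t ^ 2) ^ (a - 1) *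
      ((1 + (t ^ 2) ^ a)⁻¹ * (1 + (t ^ 2) ^ a)⁻¹))) = ENNReal.ofReal (c * (Real.pi / (4 * a))) := by
  set G : ℝ → ℝ := fun u => c / a * ((Real.arctan u - u / (1 + u ^ 2)) / 2) with hG
  have hGd : ∀ u, HasDerivAt G (c / a * (u ^ 2 / (1 + u ^ 2) ^ 2)) u := fun u => by
    have h1 : 1 + u ^ 2 ≠ 0 := by positivity
    refine ((((Real.hasDerivAt_arctan u).sub ((hasDerivAt_id u).div
      ((hasDerivAt_pow 2 u).const_add 1) h1)).div_const 2).const_mul (c / a)).congr_deriv ?_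
    simp only [id]
    field_simp
    push_cast
    ring
  have hGc : Continuous G := continuous_iff_continuousAt.2 fun u => (hGd u).continuousAt
  have hd : ∀ t ∈ Ioi (0 : ℝ), HasDerivAt (fun t : ℝ => G (t ^ a)) (c * t ^ a * t *
      (1 * (t ^ 2) ^ (a - 1) * ((1 + (t ^ 2) ^ a)⁻¹ * (1 + (t ^ 2) ^ a)⁻¹))) t := fun t ht => by
    have ht' : 0 < t := ht
    refine ((hGd (t ^ a)).comp t (Real.hasDerivAt_rpow_const (Or.inl ht'.ne'))).congr_deriv ?_
    have e : (t ^ 2) ^ a = (t ^ a) ^ 2 := by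
      rw [← Real.rpow_natCast, ← Real.rpow_mul ht'.le, mul_comm, Real.rpow_mul ht'.le,
        Real.rpow_natCast]
    rw [Real.rpow_sub_one ht'.ne', Real.rpow_sub_one (by positivity), e]
    field_simp
  have hn : ∀ t ∈ Ioi (0 : ℝ), 0 ≤ c * t ^ a * t *
      (1 * (t ^ 2) ^ (a - 1) * ((1 + (t ^ 2) ^ a)⁻¹ * (1 + (t ^ 2) ^ a)⁻¹)) := fun t ht => by
    have ht' : 0 < t := ht
    positivity
  have hfrac : Tendsto (fun u : ℝ => u / (1 + u ^ 2)) atTop (𝓝 0) := by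
    refine tendsto_of_tendsto_of_tendsto_of_le_of_le' tendsto_const_nhds
      tendsto_inv_atTop_zero ?_ ?_
    · filter_upwards [eventually_gt_atTop 0] with u hu
      positivity
    · filter_upwards [eventually_gt_atTop 0] with u hu
      rw [inv_eq_one_div, div_le_div_iff₀ (by positivity) hu]
      nlinarith
  have hGlim : Tendsto G atTop (𝓝 (c / a * ((Real.pi / 2 - 0) / 2))) :=
    (((Real.tendsto_arctan_atTop.mono_right nhdsWithin_le_nhds).sub hfrac).div_const 2).const_mul _
  have hlim := hGlim.comp (tendsto_rpow_atTop ha)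
  have hcont : ContinuousWithinAt (fun t : ℝ => G (t ^ a)) (Ici 0) 0 :=
    (hGc.comp (Real.continuous_rpow_const ha.le)).continuousWithinAt
  have h1 := integral_Ioi_of_hasDerivAt_of_nonneg hcont hd hn hlim
  have h2 := integrableOn_Ioi_deriv_of_nonneg hcont hd hn hlim
  rw [← ofReal_integral_eq_lintegral_ofReal h2, h1]
  · congr 1
    simp only [hG, Real.zero_rpow ha.ne', Real.arctan_zero]
    field_simp
    ring
  · filter_upwards [ae_restrict_mem measurableSet_Ioi] with t ht using hn t ht

/-- If `S : [0,∞) → [0,∞)` is continuous, increasing and satisfies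
`∫₀¹ S(t·x)(1−x²)^{n−2} x dx ≤ t^λ` for all `t ≥ 0`, with `1/2 ≤ λ ≤ 1`, then
`∫₀^∞ S(t)·t^{2λ−1}/(1+t^{2λ})² dt ≤ (π(n−1)/(2λ))·∏_{k=1}^{n−1}(1+λ/(2k))`. -/
theorem stmt_0 (n : ℕ) (hn : 2 ≤ n) (lam : ℝ) (hlam1 : 1/2 ≤ lam) (hlam2 : lam ≤ 1)
    (S : ℝ → ℝ) (hScont : ContinuousOn S (Set.Ici 0))
    (hSnonneg : ∀ x ∈ Set.Ici (0:ℝ), 0 ≤ S x)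
    (hSmono : MonotoneOn S (Set.Ici 0))
    (hyp : ∀ t ∈ Set.Ici (0:ℝ),
      ∫ x in (0:ℝ)..1, S (t * x) * (1 - x^2)^(n-2) * x ≤ t ^ lam) :
    ∫ t in Set.Ioi (0:ℝ), S t * t ^ (2*lam - 1) / (1 + t ^ (2*lam))^2 ≤
      (Real.pi * ((n:ℝ) - 1) / (2*lam)) *
        ∏ k ∈ Finset.Icc 1 (n-1), (1 + lam / (2*(k:ℝ))) := by
  obtain ⟨p, rfl⟩ : ∃ p, n = p + 2 := ⟨n - 2, by omega⟩
  simp only [Nat.add_sub_cancel, show p + 2 - 1 = p + 1 from rfl] at hyp ⊢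
  have hl : 0 < lam := by linarith
  have hinv := CompletelyMonotoneUpTo.inv_one_add_rpow (p + 1) hl.le hlam2
  have hinvlim : Tendsto (fun v : ℝ => (1 + v ^ lam)⁻¹) atTop (𝓝 0) :=
    (tendsto_atTop_add_const_left _ 1 (tendsto_rpow_atTop hl)).inv_tendsto_atTop
  have hmono := (CompletelyMonotoneUpTo.const_mul_rpow (p + 1) zero_le_one
    (by linarith : lam - 1 ≤ 0)).mul (hinv.mul hinv)
  have hlim : Tendsto (fun v : ℝ => 1 * v ^ (lam - 1) * ((1 + v ^ lam)⁻¹ * (1 + v ^ lam)⁻¹))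
      atTop (𝓝 0) := by
    refine tendsto_of_tendsto_of_tendsto_of_le_of_le' tendsto_const_nhds
      (by simpa using hinvlim.mul hinvlim) ?_ ?_
    · filter_upwards [eventually_gt_atTop 0] with v hv
      exact hmono.nonneg v hv
    · filter_upwards [eventually_ge_atTop 1] with v hv
      have h1 := Real.rpow_le_one_of_one_le_of_nonpos hv (by linarith : lam - 1 ≤ 0)
      have h2 : 0 ≤ (1 + v ^ lam)⁻¹ * (1 + v ^ lam)⁻¹ := mul_self_nonneg _
      nlinarith
  obtain ⟨H, hH, hrep⟩ := hmono.exists_lintegral_repr hlim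
  set c : ℝ := 2 * ((p : ℝ) + 1) * ∏ k ∈ Finset.Icc 1 (p + 1), (1 + lam / (2 * (k : ℝ))) with hc
  have hc0 : 0 < c := mul_pos (by positivity) (Finset.prod_pos fun k _ => by positivity)
  have hSc : Continuous fun x => S (max x 0) :=
    hScont.comp_continuous (by fun_prop) fun x => mem_Ici.2 (le_max_right _ _)
  have key1 := lintegral_Ioi_eq_lintegral_beta_transform hH hrep hSc
    fun x _ => hSnonneg _ (mem_Ici.2 (le_max_right _ _))
  have key2 := lintegral_Ioi_eq_lintegral_beta_transform hH hrep
    ((Real.continuous_rpow_const hl.le).const_mul c)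
    fun x hx => mul_nonneg hc0.le (Real.rpow_nonneg hx _)
  rw [lintegral_rpow_div_one_add_sq hl hc0.le] at key2
  have hbound : ∫⁻ t in Ioi (0 : ℝ), ENNReal.ofReal (S t * t ^ (2 * lam - 1) /
      (1 + t ^ (2 * lam)) ^ 2) ≤ ENNReal.ofReal (c * (Real.pi / (4 * lam))) := by
    have e : ∀ t ∈ Ioi (0 : ℝ), ENNReal.ofReal (S t * t ^ (2 * lam - 1) /
        (1 + t ^ (2 * lam)) ^ 2) = ENNReal.ofReal (S (max t 0) * t * (1 * (t ^ 2) ^ (lam - 1) *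
          ((1 + (t ^ 2) ^ lam)⁻¹ * (1 + (t ^ 2) ^ lam)⁻¹))) := fun t ht => by
      have ht' : 0 < t := ht
      rw [max_eq_left ht'.le, Real.rpow_sub_one ht'.ne', Real.rpow_mul ht'.le,
        Real.rpow_sub_one (by positivity), Real.rpow_two]
      congr 1
      field_simp
    rw [setLIntegral_congr_fun measurableSet_Ioi e, key1, key2]
    refine lintegral_mono fun y => mul_le_mul_right (ENNReal.ofReal_le_ofReal ?_) _
    have h1 : ∫ x in (0 : ℝ)..1, S (max (√y * x) 0) * (1 - x ^ 2) ^ p * x ≤ √y ^ lam := by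
      refine le_of_eq_of_le (intervalIntegral.integral_congr fun x hx => ?_)
        (hyp √y (Real.sqrt_nonneg y))
      rw [uIcc_of_le zero_le_one] at hx
      rw [max_eq_left (mul_nonneg (Real.sqrt_nonneg y) hx.1)]
    refine h1.trans_eq ?_
    have h2 : ∫ x in (0 : ℝ)..1, c * (√y * x) ^ lam * (1 - x ^ 2) ^ p * x =
        ∫ x in (0 : ℝ)..1, c * √y ^ lam * (x ^ lam * (1 - x ^ 2) ^ p * x) := by
      refine intervalIntegral.integral_congr fun x hx => ?_
      rw [uIcc_of_le zero_le_one] at hx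
      rw [Real.mul_rpow (Real.sqrt_nonneg y) hx.1]
      ring
    rw [h2, intervalIntegral.integral_const_mul, integral_rpow_mul_one_sub_sq_pow hl, ← hc]
    field_simp
  have hfin : (Real.pi * (((p + 2 : ℕ) : ℝ) - 1) / (2 * lam)) *
      ∏ k ∈ Finset.Icc 1 (p + 1), (1 + lam / (2 * (k : ℝ))) = c * (Real.pi / (4 * lam)) := by
    rw [hc]
    push_cast
    field_simp
    ring
  rw [hfin, integral_eq_lintegral_of_nonneg_ae]
  · exact ENNReal.toReal_le_of_le_ofReal (by positivity) hbound
  · filter_upwards [ae_restrict_mem measurableSet_Ioi] with t ht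
    have ht' : 0 < t := ht
    have := hSnonneg t ht'.le
    simp only [Pi.zero_apply]
    positivity
  · refine AEStronglyMeasurable.div₀ ?_ ?_
    · exact ((hScont.mono Ioi_subset_Ici_self).aestronglyMeasurable measurableSet_Ioi).mul
        (Measurable.aestronglyMeasurable (by fun_prop))
    · exact Measurable.aestronglyMeasurable (by fun_prop)
end

section
/- Let n ≥ 2 be an integer and λ > 0 a real number. Let S : [0,∞) → [0,∞) be an increasing function such that ∫₀¹ S(t·x)(1−x²)^{n−2} x dx ≤ t^λ for all t ∈ [0,∞). Then for all x ≥ 0, S(x) ≤ 2(n−1)·(1 + λ/(2(n−1)))^{n−1}·(1 + 2(n−1)/λ)^{λ/2}·x^λ. -/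
/-- The weight `(1 - u²)^k u` has antiderivative `-(1 - u²)^(k+1) / (2(k+1))`. -/
theorem integral_one_sub_sq_pow_mul_self (k : ℕ) (a : ℝ) :
    ∫ u in a..1, (1 - u ^ 2) ^ k * u = (1 - a ^ 2) ^ (k + 1) / (2 * ((k : ℝ) + 1)) := by
  have hk : (2 * ((k : ℝ) + 1)) ≠ 0 := by positivity
  have hderiv : ∀ u ∈ Set.uIcc a 1, HasDerivAt
      (fun u : ℝ => -((1 - u ^ 2) ^ (k + 1)) / (2 * ((k : ℝ) + 1)))
      ((1 - u ^ 2) ^ k * u) u := by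
    intro u _
    have h := ((((hasDerivAt_id u).pow 2).const_sub 1).pow (k + 1)).neg.div_const
      (2 * ((k : ℝ) + 1))
    refine HasDerivAt.congr_deriv h ?_
    simp only [Nat.add_sub_cancel, id, Pi.pow_apply]
    field_simp
    push_cast
    ring
  rw [intervalIntegral.integral_eq_sub_of_hasDerivAt hderiv
    (Continuous.intervalIntegrable (by fun_prop) _ _)]
  simp
  ring

/-- Lower bound for the weighted mean of a nonnegative monotone function. -/
theorem MonotoneOn.mul_pow_le_integral {f : ℝ → ℝ} (hf : MonotoneOn f (Set.Icc 0 1))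
    (hf0 : ∀ u ∈ Set.Icc (0 : ℝ) 1, 0 ≤ f u) (k : ℕ) {a : ℝ} (ha : a ∈ Set.Icc (0 : ℝ) 1) :
    f a * ((1 - a ^ 2) ^ (k + 1) / (2 * ((k : ℝ) + 1))) ≤
      ∫ u in (0 : ℝ)..1, f u * (1 - u ^ 2) ^ k * u := by
  have hint : IntervalIntegrable (fun u => f u * (1 - u ^ 2) ^ k * u)
      MeasureTheory.volume 0 1 := by
    have h : IntervalIntegrable f MeasureTheory.volume 0 1 :=
      MonotoneOn.intervalIntegrable (by rwa [Set.uIcc_of_le zero_le_one])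
    exact (h.mul_continuousOn (by fun_prop)).mul_continuousOn (by fun_prop)
  have hw : ∀ u ∈ Set.Icc (0 : ℝ) 1, 0 ≤ (1 - u ^ 2) ^ k * u := fun u hu =>
    mul_nonneg (pow_nonneg (by nlinarith [hu.1, hu.2]) _) hu.1
  have hint0 := hint.mono_set (c := 0) (d := a) (by
    rw [Set.uIcc_of_le ha.1, Set.uIcc_of_le zero_le_one]
    exact Set.Icc_subset_Icc_right ha.2)
  have hint1 := hint.mono_set (c := a) (d := 1) (by
    rw [Set.uIcc_of_le ha.2, Set.uIcc_of_le zero_le_one]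
    exact Set.Icc_subset_Icc_left ha.1)
  have h0 : 0 ≤ ∫ u in (0 : ℝ)..a, f u * (1 - u ^ 2) ^ k * u := by
    refine intervalIntegral.integral_nonneg ha.1 fun u hu => ?_
    have hu' : u ∈ Set.Icc (0 : ℝ) 1 := ⟨hu.1, hu.2.trans ha.2⟩
    rw [mul_assoc]
    exact mul_nonneg (hf0 u hu') (hw u hu')
  have h1 : ∫ u in a..1, f a * ((1 - u ^ 2) ^ k * u) ≤
      ∫ u in a..1, f u * (1 - u ^ 2) ^ k * u := by
    refine intervalIntegral.integral_mono_on ha.2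
      (Continuous.intervalIntegrable (by fun_prop) _ _) hint1 fun u hu => ?_
    have hu' : u ∈ Set.Icc (0 : ℝ) 1 := ⟨ha.1.trans hu.1, hu.2⟩
    rw [mul_assoc]
    exact mul_le_mul_of_nonneg_right (hf ha hu' hu.1) (hw u hu')
  rw [intervalIntegral.integral_const_mul, integral_one_sub_sq_pow_mul_self] at h1
  rw [← intervalIntegral.integral_add_adjacent_intervals hint0 hint1]
  linarith


/-- Lemma 1: a rough pointwise bound for an increasing positive `S`
satisfying `∫₀¹ S(t·x)(1−x²)^{n−2} x dx ≤ t^λ` for all `t ≥ 0`. -/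
theorem stmt_3 (n : ℕ) (hn : 2 ≤ n) (lam : ℝ) (hlam : 0 < lam)
    (S : ℝ → ℝ)
    (hSnonneg : ∀ x ∈ Set.Ici (0:ℝ), 0 ≤ S x)
    (hSmono : MonotoneOn S (Set.Ici 0))
    (hyp : ∀ t ∈ Set.Ici (0:ℝ),
      ∫ x in (0:ℝ)..1, S (t * x) * (1 - x^2)^(n-2) * x ≤ t ^ lam) :
    ∀ x : ℝ, 0 ≤ x →
      S x ≤ 2 * ((n:ℝ) - 1) * (1 + lam / (2*((n:ℝ) - 1)))^(n-1) *
        (1 + 2*((n:ℝ) - 1)/lam) ^ (lam/2) * x ^ lam := by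
  intro x hx
  obtain ⟨k, rfl⟩ := Nat.exists_eq_add_of_le' hn
  have hm : (((k + 2 : ℕ) : ℝ) - 1) = (k : ℝ) + 1 := by push_cast; ring
  rw [hm]
  set m : ℝ := (k : ℝ) + 1 with hm_def
  have hm0 : 0 < m := by positivity
  set c : ℝ := 1 + 2 * m / lam with hc
  have hc1 : 1 ≤ c := by
    have : 0 ≤ 2 * m / lam := by positivity
    linarith
  have hc0 : 0 < c := by linarith
  have hs0 : 0 < √c := Real.sqrt_pos.2 hc0
  have hs1 : 1 ≤ √c := Real.one_le_sqrt.2 hc1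
  have ht0 : 0 ≤ x * √c := by positivity
  have hmono : MonotoneOn (fun u => S (x * √c * u)) (Set.Icc 0 1) := fun u hu v hv huv =>
    hSmono (mul_nonneg ht0 hu.1) (mul_nonneg ht0 hv.1) (mul_le_mul_of_nonneg_left huv ht0)
  have key := (hmono.mul_pow_le_integral (fun u hu => hSnonneg _ (mul_nonneg ht0 hu.1)) k
    (a := (√c)⁻¹) ⟨by positivity, inv_le_one_of_one_le₀ hs1⟩).trans (hyp _ ht0)
  have hpow : (√c) ^ lam = c ^ (lam / 2) := by
    rw [Real.sqrt_eq_rpow, ← Real.rpow_mul hc0.le]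
    congr 1
    ring
  have hweight : 1 - (√c)⁻¹ ^ 2 = (1 + lam / (2 * m))⁻¹ := by
    rw [inv_pow, Real.sq_sqrt hc0.le, hc]
    field_simp
    ring
  rw [mul_inv_cancel_right₀ hs0.ne', Real.mul_rpow hx hs0.le, hpow, hweight, ← hm_def,
    inv_pow] at key
  have hd : 0 < (1 + lam / (2 * m)) ^ (k + 1) := by positivity
  have hexp : k + 2 - 1 = k + 1 := rfl
  rw [hexp]
  calc S x = S x * (((1 + lam / (2 * m)) ^ (k + 1))⁻¹ / (2 * m)) *
        (2 * m * (1 + lam / (2 * m)) ^ (k + 1)) := by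
        generalize (1 + lam / (2 * m)) ^ (k + 1) = d at hd
        field_simp
    _ ≤ x ^ lam * c ^ (lam / 2) * (2 * m * (1 + lam / (2 * m)) ^ (k + 1)) :=
        mul_le_mul_of_nonneg_right key (by positivity)
    _ = _ := by ring
end

section
/- Let n ≥ 2 be an integer and λ > 0 a real number. Let S : [0,∞) → [0,∞) be an increasing function such that ∫₀¹ S(t·x)(1−x²)^{n−2} x dx ≤ t^λ for all t ∈ [0,∞). Then for every a ∈ (0,1) and every t ≥ 0, S(a·t) ≤ (2(n−1)/(1−a²)^{n−1})·t^λ. -/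
theorem integral_one_sub_sq_pow_mul (m : ℕ) (a b : ℝ) :
    ∫ x in a..b, (1 - x ^ 2) ^ m * x =
      ((1 - a ^ 2) ^ (m + 1) - (1 - b ^ 2) ^ (m + 1)) / (2 * ((m : ℝ) + 1)) := by
  have hm : (m : ℝ) + 1 ≠ 0 := by positivity
  have hderiv : ∀ x ∈ Set.uIcc a b,
      HasDerivAt (fun x : ℝ => -(1 - x ^ 2) ^ (m + 1) / (2 * ((m : ℝ) + 1)))
        ((1 - x ^ 2) ^ m * x) x := by
    intro x _
    have h := ((((hasDerivAt_pow 2 x).const_sub 1).fun_pow (m + 1)).fun_neg).div_const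
      (2 * ((m : ℝ) + 1))
    refine h.congr_deriv ?_
    push_cast
    field_simp
  rw [intervalIntegral.integral_eq_sub_of_hasDerivAt hderiv
    (Continuous.intervalIntegrable (by fun_prop) _ _)]
  ring

/-- for an increasing positive `S` satisfying the integral condition,
`S(a·t) ≤ (2(n−1)/(1−a²)^{n−1})·t^λ` for every `a ∈ (0,1)` and `t ≥ 0`. -/
theorem stmt_4 (n : ℕ) (hn : 2 ≤ n) (lam : ℝ) (hlam : 0 < lam)
    (S : ℝ → ℝ)
    (hSnonneg : ∀ x ∈ Set.Ici (0:ℝ), 0 ≤ S x)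
    (hSmono : MonotoneOn S (Set.Ici 0))
    (hyp : ∀ t ∈ Set.Ici (0:ℝ),
      ∫ x in (0:ℝ)..1, S (t * x) * (1 - x^2)^(n-2) * x ≤ t ^ lam) :
    ∀ a ∈ Set.Ioo (0:ℝ) 1, ∀ t : ℝ, 0 ≤ t →
      S (a * t) ≤ (2 * ((n:ℝ) - 1) / (1 - a^2)^(n-1)) * t ^ lam := by
  rintro a ⟨ha0, ha1⟩ t ht
  obtain ⟨m, rfl⟩ := Nat.exists_eq_add_of_le' hn
  have hcast : ((m + 2 : ℕ) : ℝ) - 1 = m + 1 := by push_cast; ring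
  have hyp' := hyp t ht
  rw [show m + 2 - 2 = m by omega] at hyp'
  rw [hcast, show m + 2 - 1 = m + 1 by omega]
  have hw : ∀ x : ℝ, 0 ≤ x → x ≤ 1 → 0 ≤ (1 - x ^ 2) ^ m * x := fun x h0 h1 =>
    mul_nonneg (pow_nonneg (by nlinarith) m) h0
  have hint : IntervalIntegrable (fun x => S (t * x) * (1 - x ^ 2) ^ m * x)
      MeasureTheory.volume 0 1 := by
    have hS : IntervalIntegrable (fun x => S (t * x)) MeasureTheory.volume 0 1 := by
      refine MonotoneOn.intervalIntegrable fun x hx y hy hxy => ?_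
      rw [Set.uIcc_of_le zero_le_one] at hx hy
      exact hSmono (mul_nonneg ht hx.1) (mul_nonneg ht hy.1)
        (mul_le_mul_of_nonneg_left hxy ht)
    exact (hS.mul_continuousOn (by fun_prop)).mul_continuousOn (by fun_prop)
  have hint' : IntervalIntegrable (fun x => S (t * x) * (1 - x ^ 2) ^ m * x)
      MeasureTheory.volume a 1 :=
    hint.mono_set (by
      rw [Set.uIcc_of_le ha1.le, Set.uIcc_of_le zero_le_one]
      exact Set.Icc_subset_Icc_left ha0.le)
  have hrestrict : ∫ x in a..1, S (t * x) * (1 - x ^ 2) ^ m * x ≤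
      ∫ x in (0:ℝ)..1, S (t * x) * (1 - x ^ 2) ^ m * x := by
    refine intervalIntegral.integral_mono_interval ha0.le ha1.le le_rfl ?_ hint
    refine (MeasureTheory.ae_restrict_iff' measurableSet_Ioc).2 (.of_forall fun x hx => ?_)
    simp only [Pi.zero_apply, mul_assoc]
    exact mul_nonneg (hSnonneg _ (mul_nonneg ht hx.1.le)) (hw x hx.1.le hx.2)
  have hlower : ∫ x in a..1, S (a * t) * ((1 - x ^ 2) ^ m * x) ≤
      ∫ x in a..1, S (t * x) * (1 - x ^ 2) ^ m * x := by
    refine intervalIntegral.integral_mono_on ha1.le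
      (Continuous.intervalIntegrable (by fun_prop) _ _) hint' fun x hx => ?_
    have hx0 : 0 ≤ x := ha0.le.trans hx.1
    rw [mul_assoc]
    refine mul_le_mul_of_nonneg_right ?_ (hw x hx0 hx.2)
    refine hSmono (mul_nonneg ha0.le ht) (mul_nonneg ht hx0) ?_
    rw [mul_comm]
    exact mul_le_mul_of_nonneg_left hx.1 ht
  rw [intervalIntegral.integral_const_mul, integral_one_sub_sq_pow_mul] at hlower
  have hpos : 0 < (1 - a ^ 2) ^ (m + 1) := pow_pos (by nlinarith) _
  have hbound := (hlower.trans hrestrict).trans hyp'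
  simp only [one_pow, sub_self, ne_eq, Nat.add_eq_zero_iff, one_ne_zero, and_false,
    not_false_eq_true, zero_pow, sub_zero] at hbound
  rw [← mul_div_assoc, div_le_iff₀ (by positivity)] at hbound
  rw [div_mul_eq_mul_div, le_div_iff₀ hpos]
  linarith
end

section
/- Let λ > 0 and define φ_λ(t) := t^{2λ−1}/(1+t^{2λ})² for t > 0, and the operator (M[φ])(r) := −(d/dt)(φ(t)/t)|_{t=r}. Then for every integer q ≥ 0: (a) M^q[φ_λ](t) = O(t^{−2λ−1−2q}) as t → +∞, i.e., there exist constants C > 0 and R > 0 with |M^q[φ_λ](t)| ≤ C·t^{−2λ−1−2q} for all t ≥ R; and (b) M^q[φ_λ](t) = O(t^{2λ−1−2q}) as t → 0⁺, i.e., there exist constants C' > 0 and r₀ > 0 with |M^q[φ_λ](t)| ≤ C'·t^{2λ−1−2q} for all 0 < t ≤ r₀. -/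
/-- The operator `M[φ](r) = −(d/dt)(φ(t)/t)|_{t=r}`. -/
noncomputable def Mop : (ℝ → ℝ) → (ℝ → ℝ) := fun φ r => -deriv (fun t => φ t / t) r

open Polynomial in
/-- One application of `Mop` to `t ^ a * s² R(s)`, where `s = 1 / (1 + t ^ b)`, gives a function of
the same shape with exponent `a - 2`. -/
lemma Mop_rpow_mul_eval {a b : ℝ} {R : ℝ[X]} {f : ℝ → ℝ}
    (hf : ∀ t > (0:ℝ), f t = t ^ a * (X ^ 2 * R).eval (1 + t ^ b)⁻¹) {t : ℝ} (ht : 0 < t) :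
    Mop f t = t ^ (a - 2) *
      (X ^ 2 * (C (1 - a) * R + C b * (1 - X) * (2 * R + X * derivative R))).eval
        (1 + t ^ b)⁻¹ := by
  have hu : 0 < t ^ b := Real.rpow_pos_of_pos ht b
  have hquot : (fun x => f x / x) =ᶠ[nhds t]
      fun x => x ^ (a - 1) * (X ^ 2 * R).eval (1 + x ^ b)⁻¹ := by
    filter_upwards [lt_mem_nhds ht] with x hx
    rw [hf x hx, Real.rpow_sub_one hx.ne']
    ring
  have hs : HasDerivAt (fun x : ℝ => (1 + x ^ b)⁻¹)
      (-(b * t ^ (b - 1)) / (1 + t ^ b) ^ 2) t :=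
    ((Real.hasDerivAt_rpow_const (Or.inl ht.ne')).const_add 1).fun_inv (by positivity)
  have hd := (Real.hasDerivAt_rpow_const (p := a - 1) (Or.inl ht.ne')).mul
    (((X ^ 2 * R).hasDerivAt (1 + t ^ b)⁻¹).comp t hs)
  have hderiv := hquot.deriv_eq.trans hd.deriv
  simp only [Mop]
  rw [hderiv]
  have e1 : t ^ (a - 1) = t ^ (a - 2) * t := by
    rw [← Real.rpow_add_one ht.ne']; congr 1; ring
  have e2 : t ^ (a - 1 - 1) = t ^ (a - 2) := by congr 1; ring
  rw [e1, e2, Real.rpow_sub_one ht.ne']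
  simp only [Function.comp, derivative_mul, derivative_X_pow, eval_mul, eval_add, eval_sub,
    eval_pow, eval_X, eval_C, eval_one, eval_ofNat]
  generalize R.eval (1 + t ^ b)⁻¹ = r
  generalize (derivative R).eval (1 + t ^ b)⁻¹ = r'
  norm_num only [Nat.cast_ofNat, pow_one]
  field_simp
  ring

open Polynomial in
lemma exists_Mop_iterate_eq_rpow_mul_eval {a b : ℝ} {R : ℝ[X]} {f : ℝ → ℝ}
    (hf : ∀ t > (0:ℝ), f t = t ^ a * (X ^ 2 * R).eval (1 + t ^ b)⁻¹) (q : ℕ) :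
    ∃ S : ℝ[X], ∀ t > (0:ℝ),
      (Mop^[q]) f t = t ^ (a - 2 * (q:ℝ)) * (X ^ 2 * S).eval (1 + t ^ b)⁻¹ := by
  induction q with
  | zero => exact ⟨R, by simpa using hf⟩
  | succ q ih =>
    obtain ⟨S, hS⟩ := ih
    refine ⟨C (1 - (a - 2 * (q:ℝ))) * S + C b * (1 - X) * (2 * S + X * derivative S),
      fun t ht => ?_⟩
    rw [Function.iterate_succ_apply', Mop_rpow_mul_eval hS ht]
    congr 2
    push_cast
    ring

/-- Lemma 3, asymptotics: for `φ_λ(t) = t^{2λ−1}/(1+t^{2λ})²`,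
`M^q[φ_λ](t) = O(t^{−2λ−1−2q})` as `t → +∞` and `M^q[φ_λ](t) = O(t^{2λ−1−2q})` as `t → 0⁺`. -/
theorem stmt_8 (lam : ℝ) (hlam : 0 < lam)
    (φ : ℝ → ℝ) (hφ : ∀ t > (0:ℝ), φ t = t ^ (2*lam - 1) / (1 + t ^ (2*lam))^2)
    (q : ℕ) :
    (∃ C > (0:ℝ), ∃ R > (0:ℝ), ∀ t : ℝ, R ≤ t →
        |(Mop^[q]) φ t| ≤ C * t ^ (-2*lam - 1 - 2*(q:ℝ))) ∧
    (∃ C' > (0:ℝ), ∃ r₀ > (0:ℝ), ∀ t : ℝ, 0 < t → t ≤ r₀ →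
        |(Mop^[q]) φ t| ≤ C' * t ^ (2*lam - 1 - 2*(q:ℝ))) := by
  obtain ⟨S, hS⟩ := exists_Mop_iterate_eq_rpow_mul_eval (a := 2*lam - 1) (b := 2*lam) (R := 1)
    (f := φ) (fun t ht => by simp [hφ t ht, div_eq_mul_inv]) q
  obtain ⟨K, hK⟩ := (isCompact_Icc (a := (0:ℝ)) (b := 1)).exists_bound_of_continuousOn
    S.continuous.continuousOn
  have hK0 : 0 ≤ K := (norm_nonneg _).trans (hK 0 (by simp))
  have key : ∀ t > (0:ℝ), |(Mop^[q]) φ t| ≤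
      (K + 1) * (t ^ (2*lam - 1 - 2*(q:ℝ)) * ((1 + t ^ (2*lam))⁻¹) ^ 2) := by
    intro t ht
    have hu : 0 < t ^ (2*lam) := Real.rpow_pos_of_pos ht _
    have h1 : (1 + t ^ (2*lam))⁻¹ ≤ 1 := inv_le_one_of_one_le₀ (by linarith)
    have hb := hK _ ⟨by positivity, h1⟩
    have hp : 0 < t ^ (2*lam - 1 - 2*(q:ℝ)) := Real.rpow_pos_of_pos ht _
    rw [Real.norm_eq_abs] at hb
    rw [hS t ht, Polynomial.eval_mul, Polynomial.eval_pow, Polynomial.eval_X, ← mul_assoc,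
      abs_mul, abs_of_nonneg (by positivity), mul_comm]
    gcongr
    linarith
  refine ⟨⟨K + 1, by positivity, 1, one_pos, fun t ht => ?_⟩,
    ⟨K + 1, by positivity, 1, one_pos, fun t ht _ => ?_⟩⟩
  · have ht0 : 0 < t := by linarith
    have hu : 0 < t ^ (2*lam) := Real.rpow_pos_of_pos ht0 _
    refine (key t ht0).trans ?_
    have e : t ^ (-2*lam - 1 - 2*(q:ℝ)) =
        t ^ (2*lam - 1 - 2*(q:ℝ)) * ((t ^ (2*lam))⁻¹) ^ 2 := by
      rw [← Real.rpow_neg ht0.le, sq, ← Real.rpow_add ht0, ← Real.rpow_add ht0]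
      congr 1
      ring
    rw [e]
    gcongr
    linarith
  · have hu : 0 < t ^ (2*lam) := Real.rpow_pos_of_pos ht _
    refine (key t ht).trans ?_
    gcongr
    refine mul_le_of_le_one_right (by positivity) (pow_le_one₀ (by positivity) ?_)
    exact inv_le_one_of_one_le₀ (by linarith)
end

section
/- Let 0 < λ ≤ 1 and define φ_λ(t) := t^{2λ−1}/(1+t^{2λ})² for t > 0, and the operator (M[φ])(r) := −(d/dt)(φ(t)/t)|_{t=r}. Then for every integer q ≥ 0 and every t > 0, M^q[φ_λ](t) ≥ 0. -/
/-- The convex cone of functions on `(0, ∞)` generated by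
`t ↦ t * (t ^ (-b) / (1 + t ^ c) ^ k)` with `0 ≤ b`. -/
inductive MopCone (c : ℝ) : (ℝ → ℝ) → Prop
  | base (b : ℝ) (k : ℕ) (hb : 0 ≤ b) : MopCone c (fun t => t * (t ^ (-b) / (1 + t ^ c) ^ k))
  | add {f g : ℝ → ℝ} (hf : MopCone c f) (hg : MopCone c g) : MopCone c (fun t => f t + g t)
  | smul {f : ℝ → ℝ} (a : ℝ) (ha : 0 ≤ a) (hf : MopCone c f) : MopCone c (fun t => a * f t)
  | congr {f g : ℝ → ℝ} (h : ∀ t, 0 < t → f t = g t) (hf : MopCone c f) : MopCone c g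

theorem MopCone.nonneg {c : ℝ} {f : ℝ → ℝ} (hf : MopCone c f) {t : ℝ} (ht : 0 < t) :
    0 ≤ f t := by
  induction hf with
  | base b k hb => positivity
  | add _ _ ihf ihg => exact add_nonneg ihf ihg
  | smul a ha _ ih => exact mul_nonneg ha ih
  | congr h _ ih => exact h t ht ▸ ih

theorem hasDerivAt_rpow_neg_div_one_add_rpow_pow (b c : ℝ) (k : ℕ) {t : ℝ} (ht : 0 < t) :
    HasDerivAt (fun t : ℝ => t ^ (-b) / (1 + t ^ c) ^ k)
      (-(b * (t * (t ^ (-(b + 2)) / (1 + t ^ c) ^ k))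
        + k * c * (t * (t ^ (-(b + 2 - c)) / (1 + t ^ c) ^ (k + 1))))) t := by
  have hpos : 0 < 1 + t ^ c := by positivity
  have h := (Real.hasDerivAt_rpow_const (p := -b) (Or.inl ht.ne')).div
    (((Real.hasDerivAt_rpow_const (p := c) (Or.inl ht.ne')).const_add 1).pow k)
    (pow_ne_zero k hpos.ne')
  refine h.congr_deriv ?_
  have h1 : t ^ (-b - 1) = t ^ (-b) / t := by rw [Real.rpow_sub ht, Real.rpow_one]
  have h2 : t ^ (c - 1) = t ^ c / t := by rw [Real.rpow_sub ht, Real.rpow_one]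
  have h3 : t ^ (-(b + 2)) = t ^ (-b) / t ^ 2 := by
    rw [neg_add, ← sub_eq_add_neg, Real.rpow_sub ht, Real.rpow_two]
  have h4 : t ^ (-(b + 2 - c)) = t ^ (-b) * t ^ c / t ^ 2 := by
    rw [show -(b + 2 - c) = -b + c - 2 by ring, Real.rpow_sub ht, Real.rpow_add ht,
      Real.rpow_two]
  rw [h1, h2, h3, h4]
  rcases k with _ | k
  · simp [field]
  · simp only [Nat.add_sub_cancel, Pi.pow_apply]
    field_simp
    ring

theorem MopCone.differentiableAt_div {c : ℝ} {f : ℝ → ℝ} (hf : MopCone c f) {t : ℝ}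
    (ht : 0 < t) : DifferentiableAt ℝ (fun t => f t / t) t := by
  induction hf with
  | base b k hb =>
    refine (hasDerivAt_rpow_neg_div_one_add_rpow_pow b c k ht).differentiableAt.congr_of_eventuallyEq
      ?_
    filter_upwards [lt_mem_nhds ht] with s hs
    exact mul_div_cancel_left₀ _ hs.ne'
  | add _ _ ihf ihg => simpa only [add_div] using ihf.fun_add ihg
  | smul a ha _ ih => simpa only [mul_div_assoc] using ih.const_mul a
  | congr h _ ih =>
    refine ih.congr_of_eventuallyEq ?_
    filter_upwards [lt_mem_nhds ht] with s hs
    rw [h s hs]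

theorem Mop_congr {f g : ℝ → ℝ} (h : ∀ t, 0 < t → f t = g t) {t : ℝ} (ht : 0 < t) :
    Mop f t = Mop g t := by
  refine congrArg Neg.neg (Filter.EventuallyEq.deriv_eq ?_)
  filter_upwards [lt_mem_nhds ht] with s hs
  rw [h s hs]

theorem MopCone.mop {c : ℝ} (hc0 : 0 ≤ c) (hc2 : c ≤ 2) {f : ℝ → ℝ} (hf : MopCone c f) :
    MopCone c (Mop f) := by
  induction hf with
  | base b k hb =>
    refine .congr (fun t ht => ?_) (.add (.smul b hb (.base (b + 2) k (by linarith)))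
      (.smul (k * c) (by positivity) (.base (b + 2 - c) (k + 1) (by linarith))))
    have h : (fun s : ℝ => s * (s ^ (-b) / (1 + s ^ c) ^ k) / s) =ᶠ[nhds t]
        fun s => s ^ (-b) / (1 + s ^ c) ^ k := by
      filter_upwards [lt_mem_nhds ht] with s hs
      exact mul_div_cancel_left₀ _ hs.ne'
    rw [Mop, h.deriv_eq, (hasDerivAt_rpow_neg_div_one_add_rpow_pow b c k ht).deriv, neg_neg]
  | add hf hg ihf ihg =>
    refine .congr (fun t ht => ?_) (.add ihf ihg)
    simp only [Mop, add_div]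
    rw [deriv_fun_add (hf.differentiableAt_div ht) (hg.differentiableAt_div ht), neg_add]
  | smul a ha hf ih =>
    refine .congr (fun t ht => ?_) (.smul a ha ih)
    simp only [Mop, mul_div_assoc]
    rw [deriv_const_mul _ (hf.differentiableAt_div ht), mul_neg]
  | congr h _ ih => exact .congr (fun t ht => Mop_congr h ht) ih

theorem MopCone.iterate_mop {c : ℝ} (hc0 : 0 ≤ c) (hc2 : c ≤ 2) {f : ℝ → ℝ}
    (hf : MopCone c f) (q : ℕ) : MopCone c (Mop^[q] f) := by
  induction q with
  | zero => exact hf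
  | succ q ih =>
    rw [Function.iterate_succ_apply']
    exact ih.mop hc0 hc2

/-- Lemma 3, positivity: for `0 < λ ≤ 1` and `φ_λ(t) = t^{2λ−1}/(1+t^{2λ})²`,
all iterates `M^q[φ_λ]` are nonnegative on `(0,∞)`. -/
theorem stmt_9 (lam : ℝ) (hlam0 : 0 < lam) (hlam1 : lam ≤ 1)
    (φ : ℝ → ℝ) (hφ : ∀ t > (0:ℝ), φ t = t ^ (2*lam - 1) / (1 + t ^ (2*lam))^2)
    (q : ℕ) :
    ∀ t : ℝ, 0 < t → 0 ≤ (Mop^[q]) φ t := by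
  intro t ht
  have hcone : MopCone (2 * lam) φ := by
    refine .congr (fun s hs => ?_) (.base (2 - 2 * lam) 2 (by linarith))
    rw [hφ s hs, ← mul_div_assoc, show 2 * lam - 1 = 1 + -(2 - 2 * lam) by ring,
      Real.rpow_add hs, Real.rpow_one]
  exact (hcone.iterate_mop (by linarith) (by linarith) q).nonneg ht
end

section
/- Let λ > 0, let C > 0, and let T : [0,∞) → [0,∞) be a continuous increasing function with T(t) ≤ C·t^λ for all t ≥ 0. For k ∈ ℕ define I_k(r; T) := ∫₀^r T(t)(r²−t²)^k t dt and the operator (L[g])(r) := g'(r)/r. Then for all integers k ≥ 0 and 0 ≤ p ≤ k+1, there exists a constant C' > 0 such that |L^p[I_k(·; T)](r)| ≤ C'·r^{λ+2(k+1−p)} for all r > 0. -/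
/-- The operator `L[g](r) = g'(r)/r`. -/
noncomputable def Lop : (ℝ → ℝ) → (ℝ → ℝ) := fun g r => deriv g r / r

/-- The integral `I_k(r; T) = ∫₀^r T(t)(r²−t²)^k t dt`. -/
noncomputable def Iop (T : ℝ → ℝ) (k : ℕ) (r : ℝ) : ℝ :=
  ∫ t in (0:ℝ)..r, T t * (r^2 - t^2)^k * t

/-- Weighted integrals `∫₀^r f(t)(r²−t²)^(k+1) dt` of a continuous `f` can be differentiated
in `r` under the integral sign. -/
theorem hasDerivAt_integral_mul_sq_sub_sq_pow (k : ℕ) {f : ℝ → ℝ} (hf : Continuous f) (r : ℝ) :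
    HasDerivAt (fun x : ℝ => ∫ t in (0:ℝ)..x, f t * (x ^ 2 - t ^ 2) ^ (k + 1))
      (2 * ((k:ℝ) + 1) * r * ∫ t in (0:ℝ)..r, f t * (r ^ 2 - t ^ 2) ^ k) r := by
  have split (n : ℕ) {g : ℝ → ℝ} (hg : Continuous g) (x : ℝ) :
      ∫ t in (0:ℝ)..x, g t * (x ^ 2 - t ^ 2) ^ (n + 1) =
        x ^ 2 * (∫ t in (0:ℝ)..x, g t * (x ^ 2 - t ^ 2) ^ n) -
          ∫ t in (0:ℝ)..x, (g t * t ^ 2) * (x ^ 2 - t ^ 2) ^ n := by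
    rw [← intervalIntegral.integral_const_mul, ← intervalIntegral.integral_sub
      (Continuous.intervalIntegrable (by fun_prop) _ _)
      (Continuous.intervalIntegrable (by fun_prop) _ _)]
    congr 1
    ext t
    ring
  have hsq : HasDerivAt (fun x : ℝ => x ^ 2) (2 * r) r := by
    simpa using hasDerivAt_pow 2 r
  induction k generalizing f with
  | zero =>
    have hf2 : Continuous fun t => f t * t ^ 2 := by fun_prop
    have h1 := hf.integral_hasStrictDerivAt 0 r |>.hasDerivAt
    have h2 := hf2.integral_hasStrictDerivAt 0 r |>.hasDerivAt
    simp_rw [split 0 hf]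
    simp only [pow_zero, mul_one]
    refine ((hsq.mul h1).sub h2).congr_deriv ?_
    push_cast
    ring
  | succ k ih =>
    have hf2 : Continuous fun t => f t * t ^ 2 := by fun_prop
    simp_rw [split (k + 1) hf]
    refine ((hsq.mul (ih hf)).sub (ih hf2)).congr_deriv ?_
    rw [split k hf]
    push_cast
    ring

/-- On the half-line, `Iop` only sees the values of `T` there, so `T` may be extended by a
constant. -/
theorem Iop_eq_integral_extension (T : ℝ → ℝ) (k : ℕ) {r : ℝ} (hr : 0 < r) :
    Iop T k r = ∫ t in (0:ℝ)..r, (T (max 0 t) * t) * (r ^ 2 - t ^ 2) ^ k := by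
  refine intervalIntegral.integral_congr fun t ht => ?_
  rw [Set.uIcc_of_le hr.le] at ht
  simp only [max_eq_right ht.1]
  ring

theorem continuous_comp_max_zero {T : ℝ → ℝ} (hT : ContinuousOn T (Set.Ici 0)) :
    Continuous fun t => T (max 0 t) :=
  hT.comp_continuous (by fun_prop) fun t => le_max_left 0 t

theorem hasDerivAt_Iop_succ {T : ℝ → ℝ} (hT : ContinuousOn T (Set.Ici 0)) (k : ℕ)
    {r : ℝ} (hr : 0 < r) :
    HasDerivAt (Iop T (k + 1)) (2 * ((k:ℝ) + 1) * r * Iop T k r) r := by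
  have hc := continuous_comp_max_zero hT
  rw [Iop_eq_integral_extension T k hr]
  refine (hasDerivAt_integral_mul_sq_sub_sq_pow k (hc.mul continuous_id) r).congr_of_eventuallyEq ?_
  filter_upwards [Ioi_mem_nhds hr] with x hx using Iop_eq_integral_extension T (k + 1) hx

theorem hasDerivAt_Iop_zero {T : ℝ → ℝ} (hT : ContinuousOn T (Set.Ici 0))
    {r : ℝ} (hr : 0 < r) : HasDerivAt (Iop T 0) (T r * r) r := by
  have hc := continuous_comp_max_zero hT
  have hg : Continuous fun t => T (max 0 t) * t := hc.mul continuous_id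
  have h := (hg.integral_hasStrictDerivAt 0 r).hasDerivAt
  simp only [max_eq_right hr.le] at h
  refine h.congr_of_eventuallyEq ?_
  filter_upwards [Ioi_mem_nhds hr] with x hx
  simpa using Iop_eq_integral_extension T 0 hx

theorem Lop_eq_of_eqOn_of_hasDerivAt {g h : ℝ → ℝ} {c d r : ℝ} (hr : 0 < r)
    (hgh : ∀ x, 0 < x → g x = c * h x) (hd : HasDerivAt h (d * r) r) :
    Lop g r = c * d := by
  have hg : HasDerivAt g (c * (d * r)) r := by
    refine (hd.const_mul c).congr_of_eventuallyEq ?_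
    filter_upwards [Ioi_mem_nhds hr] with x hx using hgh x hx
  rw [Lop, hg.deriv]
  field_simp

theorem abs_Iop_le {T : ℝ → ℝ} {lam C : ℝ} (hlam : 0 ≤ lam) (hC : 0 ≤ C)
    (hT0 : ∀ t, 0 ≤ t → 0 ≤ T t) (hTb : ∀ t, 0 ≤ t → T t ≤ C * t ^ lam)
    (k : ℕ) {r : ℝ} (hr : 0 < r) :
    |Iop T k r| ≤ C * r ^ (lam + 2 * ((k:ℝ) + 1)) := by
  have key : ∀ t ∈ Set.uIoc 0 r,
      ‖T t * (r ^ 2 - t ^ 2) ^ k * t‖ ≤ C * r ^ lam * (r ^ 2) ^ k * r := by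
    intro t ht
    rw [Set.uIoc_of_le hr.le] at ht
    obtain ⟨ht0, htr⟩ := ht
    have h0 : 0 ≤ r ^ 2 - t ^ 2 := by nlinarith
    have h1 : r ^ 2 - t ^ 2 ≤ r ^ 2 := by nlinarith
    have hT := hT0 t ht0.le
    have hTr : T t ≤ C * r ^ lam := (hTb t ht0.le).trans (by gcongr)
    rw [Real.norm_of_nonneg (by positivity)]
    gcongr
  have h := intervalIntegral.norm_integral_le_of_norm_le_const key
  rw [Real.norm_eq_abs, sub_zero, abs_of_pos hr] at h
  refine h.trans_eq ?_
  rw [Real.rpow_add hr, show (2:ℝ) * ((k:ℝ) + 1) = ((2 * (k + 1) : ℕ) : ℝ) by push_cast; ring,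
    Real.rpow_natCast]
  ring

theorem exists_abs_iterate_Lop_le {T : ℝ → ℝ} {lam C : ℝ} (hlam : 0 ≤ lam) (hC : 0 < C)
    (hT : ContinuousOn T (Set.Ici 0))
    (hT0 : ∀ t, 0 ≤ t → 0 ≤ T t) (hTb : ∀ t, 0 ≤ t → T t ≤ C * t ^ lam)
    (p k : ℕ) (hp : p ≤ k + 1) (g : ℝ → ℝ) (c : ℝ) (hg : ∀ x, 0 < x → g x = c * Iop T k x) :
    ∃ C' > (0:ℝ), ∀ r : ℝ, 0 < r →
      |(Lop^[p]) g r| ≤ C' * r ^ (lam + 2 * ((k:ℝ) + 1 - (p:ℝ))) := by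
  induction p generalizing k g c with
  | zero =>
    refine ⟨(|c| + 1) * C, by positivity, fun r hr => ?_⟩
    have h := abs_Iop_le hlam hC.le hT0 hTb k hr
    rw [Function.iterate_zero_apply, hg r hr, abs_mul, mul_assoc, Nat.cast_zero, sub_zero]
    gcongr
    linarith
  | succ p ih =>
    simp only [Function.iterate_succ_apply]
    cases k with
    | zero =>
      obtain rfl : p = 0 := by omega
      refine ⟨(|c| + 1) * C, by positivity, fun r hr => ?_⟩
      rw [Function.iterate_zero_apply,
        Lop_eq_of_eqOn_of_hasDerivAt hr hg (hasDerivAt_Iop_zero hT hr), abs_mul,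
        abs_of_nonneg (hT0 r hr.le), mul_assoc]
      have h := hTb r hr.le
      have h0 := hT0 r hr.le
      simp only [Nat.cast_zero, zero_add, Nat.cast_one, sub_self, mul_zero, add_zero]
      gcongr
      linarith
    | succ k =>
      obtain ⟨C', hC', h⟩ := ih k (by omega) (Lop g) (c * (2 * ((k:ℝ) + 1))) fun x hx => by
        rw [Lop_eq_of_eqOn_of_hasDerivAt (d := 2 * ((k:ℝ) + 1) * Iop T k x) hx hg
          (by convert hasDerivAt_Iop_succ hT k hx using 1; ring)]
        ring
      refine ⟨C', hC', fun r hr => ?_⟩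
      convert h r hr using 4
      push_cast
      ring

/-- Lemma 4: `L^p[I_k(·;T)](r) = O(r^{λ+2(k+1−p)})` uniformly on `(0,∞)`
whenever `T` is continuous, increasing, nonnegative and `T(t) ≤ C·t^λ`. -/
theorem stmt_11 (lam : ℝ) (hlam : 0 < lam) (C : ℝ) (hC : 0 < C)
    (T : ℝ → ℝ) (hTcont : ContinuousOn T (Set.Ici 0))
    (hTnonneg : ∀ t ∈ Set.Ici (0:ℝ), 0 ≤ T t)
    (hTmono : MonotoneOn T (Set.Ici 0))
    (hTbound : ∀ t : ℝ, 0 ≤ t → T t ≤ C * t ^ lam)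
    (k p : ℕ) (hp : p ≤ k + 1) :
    ∃ C' > (0:ℝ), ∀ r : ℝ, 0 < r →
      |(Lop^[p]) (Iop T k) r| ≤ C' * r ^ (lam + 2*((k:ℝ) + 1 - (p:ℝ))) := by
  exact exists_abs_iterate_Lop_le hlam.le hC hTcont hTnonneg hTbound p k hp (Iop T k) 1
    fun x _ => (one_mul _).symm
end

section
/- Fix an integer n ≥ 2 and a real number λ ≥ 1/2, and set α := λ/2. Then the following two statements are equivalent. (A) For every increasing function S : [0,∞) → [0,∞) that is convex relative to log (i.e., x ↦ S(e^x) is convex on ℝ) and satisfies ∫₀¹ S(t·x)(1−x²)^{n−2} x dx ≤ t^λ for all t ≥ 0, one has ∫₀^∞ S(t)·t^{2λ−1}/(1+t^{2λ})² dt ≤ (π(n−1)/(2λ))·∏_{k=1}^{n−1}(1+λ/(2k)). (B) For every increasing function h : [0,∞) → [0,∞) satisfying ∫₀¹ (h(t·x)/x)·(1−x)^{n−1} dx ≤ t^α for all t ≥ 0, one has ∫₀^∞ h(t)/(t·(1+t^{2α})) dt ≤ (π/2)·∏_{k=1}^{n−1}(1+α/k). -/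
open Set MeasureTheory Filter Topology

theorem integral_integral_swap_of_nonneg {X Y : Type*} [MeasurableSpace X] [MeasurableSpace Y]
    {μ : Measure X} {ν : Measure Y} [SFinite μ] [SFinite ν] {f : X → Y → ℝ}
    (hf : AEStronglyMeasurable (Function.uncurry f) (μ.prod ν))
    (hx : ∀ᵐ x ∂μ, 0 ≤ᵐ[ν] f x) (hy : ∀ᵐ y ∂ν, 0 ≤ᵐ[μ] fun x => f x y)
    (hxi : ∀ᵐ x ∂μ, Integrable (f x) ν) (hyi : ∀ᵐ y ∂ν, Integrable (fun x => f x y) μ) :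
    ∫ x, ∫ y, f x y ∂ν ∂μ = ∫ y, ∫ x, f x y ∂μ ∂ν := by
  rw [integral_eq_lintegral_of_nonneg_ae (hx.mono fun x h => integral_nonneg_of_ae h)
      hf.integral_prod_right',
    integral_eq_lintegral_of_nonneg_ae (hy.mono fun y h => integral_nonneg_of_ae h)
      hf.prod_swap.integral_prod_right']
  congr 1
  calc ∫⁻ x, ENNReal.ofReal (∫ y, f x y ∂ν) ∂μ
      = ∫⁻ x, ∫⁻ y, ENNReal.ofReal (f x y) ∂ν ∂μ := by
        refine lintegral_congr_ae ?_
        filter_upwards [hx, hxi] with x h hi using ofReal_integral_eq_lintegral_ofReal hi h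
    _ = ∫⁻ y, ∫⁻ x, ENNReal.ofReal (f x y) ∂μ ∂ν :=
        lintegral_lintegral_swap hf.aemeasurable.ennreal_ofReal
    _ = ∫⁻ y, ENNReal.ofReal (∫ x, f x y ∂μ) ∂ν := by
        refine lintegral_congr_ae ?_
        filter_upwards [hy, hyi] with y h hi using
          (ofReal_integral_eq_lintegral_ofReal hi h).symm

theorem setIntegral_Ioi_primitive_mul {q w : ℝ → ℝ}
    (hq : AEStronglyMeasurable q (volume.restrict (Ioi 0))) (hq0 : ∀ v, 0 < v → 0 ≤ q v)
    (hqi : ∀ u, 0 < u → IntervalIntegrable q volume 0 u)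
    (hw : IntegrableOn w (Ioi 0)) (hw0 : ∀ y, 0 < y → 0 ≤ w y) :
    ∫ y in Ioi (0 : ℝ), (∫ v in (0 : ℝ)..y, q v) * w y =
      ∫ v in Ioi (0 : ℝ), q v * ∫ y in Ioi v, w y := by
  have hpos : ∀ᵐ y ∂(volume.restrict (Ioi (0 : ℝ))), 0 < y := ae_restrict_mem measurableSet_Ioi
  let f : ℝ → ℝ → ℝ := fun y v => if v ≤ y then q v * w y else 0
  have hfx : ∀ y, f y = (Iic y).indicator fun v => q v * w y := fun y => by
    ext v; simp [f, indicator_apply]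
  have hfy : ∀ v, (fun y => f y v) = (Ici v).indicator fun y => q v * w y := fun v => by
    ext y; simp [f, indicator_apply]
  have hf0 : ∀ y v, 0 < y → 0 < v → 0 ≤ f y v := fun y v hy hv => by
    simp only [f]; split_ifs
    · exact mul_nonneg (hq0 v hv) (hw0 y hy)
    · exact le_rfl
  have hfm : AEStronglyMeasurable (Function.uncurry f)
      ((volume.restrict (Ioi (0 : ℝ))).prod (volume.restrict (Ioi (0 : ℝ)))) := by
    have h1 : AEStronglyMeasurable (fun p : ℝ × ℝ => q p.2 * w p.1)
        ((volume.restrict (Ioi (0 : ℝ))).prod (volume.restrict (Ioi (0 : ℝ)))) :=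
      hq.comp_snd.mul hw.aestronglyMeasurable.comp_fst
    have h2 : Function.uncurry f = {p : ℝ × ℝ | p.2 ≤ p.1}.indicator
        fun p : ℝ × ℝ => q p.2 * w p.1 := by
      ext p; simp [f, indicator_apply, Function.uncurry]
    rw [h2]
    exact h1.indicator (measurableSet_le measurable_snd measurable_fst)
  have key := integral_integral_swap_of_nonneg hfm
    (hpos.mono fun y hy => hpos.mono fun v hv => hf0 y v hy hv)
    (hpos.mono fun v hv => hpos.mono fun y hy => hf0 y v hy hv)
    (hpos.mono fun y hy => by
      rw [hfx, integrable_indicator_iff measurableSet_Iic, IntegrableOn,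
        Measure.restrict_restrict measurableSet_Iic, inter_comm, Ioi_inter_Iic]
      exact (((intervalIntegrable_iff_integrableOn_Ioc_of_le hy.le).1 (hqi y hy)).mul_const _))
    (Eventually.of_forall fun v => by
      rw [hfy]
      exact (hw.const_mul _).indicator measurableSet_Ici)
  calc _ = ∫ y in Ioi (0 : ℝ), ∫ v in Ioi (0 : ℝ), f y v := by
        refine setIntegral_congr_fun measurableSet_Ioi fun y hy => ?_
        simp only [hfx]
        rw [setIntegral_indicator measurableSet_Iic, Ioi_inter_Iic, integral_mul_const,
          intervalIntegral.integral_of_le (le_of_lt hy)]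
    _ = _ := key
    _ = _ := by
        refine setIntegral_congr_fun measurableSet_Ioi fun v hv => ?_
        simp only [hfy]
        rw [setIntegral_indicator measurableSet_Ici, inter_eq_right.2 (Ici_subset_Ioi.2 hv),
          integral_const_mul, integral_Ici_eq_integral_Ioi]

theorem setIntegral_Ioi_comp_sq (g : ℝ → ℝ) :
    ∫ x in Ioi (0 : ℝ), 2 * x * g (x ^ 2) = ∫ y in Ioi (0 : ℝ), g y := by
  rw [← integral_comp_rpow_Ioi g two_ne_zero]
  refine setIntegral_congr_fun measurableSet_Ioi fun x _ => ?_
  norm_num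

theorem integral_zero_one_comp_sq (g : ℝ → ℝ) :
    ∫ x in (0 : ℝ)..1, 2 * x * g (x ^ 2) = ∫ y in (0 : ℝ)..1, g y := by
  have h := setIntegral_Ioi_comp_sq ((Iic 1).indicator g)
  rw [setIntegral_indicator measurableSet_Iic, Ioi_inter_Iic] at h
  rw [intervalIntegral.integral_of_le zero_le_one, intervalIntegral.integral_of_le zero_le_one,
    ← h, ← Ioi_inter_Iic, ← setIntegral_indicator measurableSet_Iic]
  refine setIntegral_congr_fun measurableSet_Ioi fun x hx => ?_
  have : x ^ 2 ≤ 1 ↔ x ≤ 1 := by rw [sq_le_one_iff₀ (le_of_lt hx)]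
  by_cases hx1 : x ≤ 1 <;> simp [this, hx1]

theorem integrableOn_and_integral_Ioi_rpow_div_sq {a v : ℝ} (ha : 0 < a) (hv : 0 ≤ v) :
    IntegrableOn (fun y : ℝ => y ^ (a - 1) / (1 + y ^ a) ^ 2) (Ioi v) ∧
    ∫ y in Ioi v, y ^ (a - 1) / (1 + y ^ a) ^ 2 = 1 / (a * (1 + v ^ a)) := by
  have hd : ∀ x ∈ Ioi v, HasDerivAt (fun y : ℝ => -(1 / a) * (1 + y ^ a)⁻¹)
      (x ^ (a - 1) / (1 + x ^ a) ^ 2) x := fun x hx => by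
    have hx0 : 0 < x := hv.trans_lt hx
    have hp : (1 + x ^ a) ≠ 0 := by positivity
    have := ((((Real.hasDerivAt_rpow_const (p := a) (Or.inl hx0.ne')).const_add 1).inv hp).const_mul
      (-(1 / a)))
    refine this.congr_deriv ?_
    field_simp
  have hc : ContinuousWithinAt (fun y : ℝ => -(1 / a) * (1 + y ^ a)⁻¹) (Ici v) v := by
    have hp : (1 + v ^ a) ≠ 0 := by positivity
    exact (((Real.continuousAt_rpow_const v a (Or.inr ha.le)).const_add 1).inv₀ hp
      |>.const_mul _).continuousWithinAt
  have hn : ∀ x ∈ Ioi v, 0 ≤ x ^ (a - 1) / (1 + x ^ a) ^ 2 := fun x hx => by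
    have hx0 : 0 < x := hv.trans_lt hx
    positivity
  have ht : Tendsto (fun y : ℝ => -(1 / a) * (1 + y ^ a)⁻¹) atTop (𝓝 0) := by
    have := (tendsto_inv_atTop_zero.comp
      (tendsto_atTop_add_const_left _ 1 (tendsto_rpow_atTop ha))).const_mul (-(1 / a))
    simpa using this
  refine ⟨integrableOn_Ioi_deriv_of_nonneg hc hd hn ht, ?_⟩
  rw [integral_Ioi_of_hasDerivAt_of_nonneg hc hd hn ht]
  field_simp
  ring

theorem integral_one_sub_pow (m : ℕ) (v : ℝ) :
    ∫ y in v..1, (1 - y) ^ m = (1 - v) ^ (m + 1) / (m + 1) := by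
  rw [intervalIntegral.integral_comp_sub_left (fun y => y ^ m) 1]
  simp

theorem aestronglyMeasurable_div_id_of_monotoneOn {h : ℝ → ℝ} (hmono : MonotoneOn h (Ici 0)) :
    AEStronglyMeasurable (fun v => h v / v) (volume.restrict (Ioi 0)) :=
  ((aemeasurable_restrict_of_monotoneOn measurableSet_Ioi
    (hmono.mono Ioi_subset_Ici_self)).div aemeasurable_id).aestronglyMeasurable

theorem setIntegral_Ioi_eq_of_eq_primitive {h S : ℝ → ℝ} (hmono : MonotoneOn h (Ici 0))
    (hnn : ∀ x ∈ Ici (0 : ℝ), 0 ≤ h x) (m : ℕ) {lam : ℝ} (hlam : 0 < lam)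
    (hint : ∀ u, 0 < u → IntervalIntegrable (fun v => h v / v) volume 0 u)
    (hS : ∀ t, 0 < t → S t = 2 * (m + 1) * ∫ v in (0 : ℝ)..t ^ 2, h v / v) :
    ∫ t in Ioi (0 : ℝ), S t * t ^ (2 * lam - 1) / (1 + t ^ (2 * lam)) ^ 2 =
      (m + 1) / lam * ∫ t in Ioi (0 : ℝ), h t / (t * (1 + t ^ lam)) := by
  have hw := integrableOn_and_integral_Ioi_rpow_div_sq hlam le_rfl
  have key := setIntegral_Ioi_primitive_mul (aestronglyMeasurable_div_id_of_monotoneOn hmono)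
    (fun v hv => div_nonneg (hnn v hv.le) hv.le) hint hw.1 (fun y hy => by positivity)
  calc _ = ∫ t in Ioi (0 : ℝ), 2 * t * ((m + 1) * ((∫ v in (0 : ℝ)..t ^ 2, h v / v) *
            ((t ^ 2) ^ (lam - 1) / (1 + (t ^ 2) ^ lam) ^ 2))) := by
        refine setIntegral_congr_fun measurableSet_Ioi fun t ht => ?_
        have ht0 : (0 : ℝ) < t := ht
        have e1 : (t ^ 2) ^ lam = t ^ (2 * lam) := by
          rw [← Real.rpow_natCast, ← Real.rpow_mul ht0.le]; norm_num
        have e2 : t ^ (2 * lam - 1) = t * (t ^ 2) ^ (lam - 1) := by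
          rw [← Real.rpow_natCast, ← Real.rpow_mul ht0.le]
          nth_rw 2 [← Real.rpow_one t]
          rw [← Real.rpow_add ht0]; congr 1; push_cast; ring
        simp only [hS t ht0, e1, e2]
        ring
    _ = (m + 1) * ∫ v in Ioi (0 : ℝ), h v / v * ∫ y in Ioi v, y ^ (lam - 1) / (1 + y ^ lam) ^ 2 := by
        rw [setIntegral_Ioi_comp_sq fun y => (m + 1) * ((∫ v in (0 : ℝ)..y, h v / v) *
            (y ^ (lam - 1) / (1 + y ^ lam) ^ 2)), integral_const_mul, key]
    _ = _ := by
        rw [← integral_const_mul, ← integral_const_mul]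
        refine setIntegral_congr_fun measurableSet_Ioi fun v hv => ?_
        have hv0 : (0 : ℝ) < v := hv
        simp only [(integrableOn_and_integral_Ioi_rpow_div_sq hlam hv0.le).2]
        have : 0 < 1 + v ^ lam := by positivity
        field_simp

theorem integral_zero_one_eq_of_eq_primitive {h S : ℝ → ℝ} (hmono : MonotoneOn h (Ici 0))
    (hnn : ∀ x ∈ Ici (0 : ℝ), 0 ≤ h x) (m : ℕ)
    (hint : ∀ u, 0 < u → IntervalIntegrable (fun v => h v / v) volume 0 u)
    (hS : ∀ t, 0 < t → S t = 2 * (m + 1) * ∫ v in (0 : ℝ)..t ^ 2, h v / v) {t : ℝ} (ht : 0 < t) :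
    ∫ x in (0 : ℝ)..1, S (t * x) * (1 - x ^ 2) ^ m * x =
      ∫ x in (0 : ℝ)..1, h (t ^ 2 * x) / x * (1 - x) ^ (m + 1) := by
  have ht2 : 0 < t ^ 2 := by positivity
  have hscale : ∀ y, ∫ v in (0 : ℝ)..t ^ 2 * y, h v / v = ∫ v in (0 : ℝ)..y, h (t ^ 2 * v) / v := by
    intro y
    have := intervalIntegral.integral_comp_mul_left (a := 0) (b := y) (fun v => h v / v) ht2.ne'
    rw [mul_zero, smul_eq_mul] at this
    rw [← mul_right_inj' (inv_ne_zero ht2.ne'), ← this, ← intervalIntegral.integral_const_mul]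
    congr 1; ext v
    by_cases hv : v = 0
    · simp [hv]
    · field_simp
  have hmono' : MonotoneOn (fun v => h (t ^ 2 * v)) (Ici 0) := fun x hx y hy hxy =>
    hmono (mul_nonneg ht2.le hx) (mul_nonneg ht2.le hy) (by gcongr)
  have hint' : ∀ u, 0 < u → IntervalIntegrable (fun v => h (t ^ 2 * v) / v) volume 0 u := by
    intro u hu
    have := ((hint (t ^ 2 * u) (by positivity)).comp_mul_left (c := t ^ 2)).const_mul (t ^ 2)
    rw [zero_div, mul_div_cancel_left₀ _ ht2.ne'] at this
    refine this.congr fun v _ => ?_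
    by_cases hv : v = 0
    · simp [hv]
    · field_simp
  have hwi : IntegrableOn ((Iic 1).indicator fun y : ℝ => (1 - y) ^ m) (Ioi 0) := by
    rw [IntegrableOn, integrable_indicator_iff measurableSet_Iic, IntegrableOn,
        Measure.restrict_restrict measurableSet_Iic, inter_comm, Ioi_inter_Iic]
    exact (Continuous.integrableOn_Icc (by fun_prop)).mono_set Ioc_subset_Icc_self
  have key := setIntegral_Ioi_primitive_mul (aestronglyMeasurable_div_id_of_monotoneOn hmono')
    (fun v hv => div_nonneg (hnn _ (mul_nonneg ht2.le hv.le)) hv.le) hint' hwi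
    (fun y _ => indicator_nonneg (s := Iic 1) (f := fun y : ℝ => (1 - y) ^ m)
      (fun y hy => pow_nonneg (sub_nonneg.2 hy) m) y)
  calc _ = ∫ x in (0 : ℝ)..1, 2 * x * ((m + 1) * ((∫ v in (0 : ℝ)..x ^ 2, h (t ^ 2 * v) / v) *
            (1 - x ^ 2) ^ m)) := by
        refine intervalIntegral.integral_congr_ae (Eventually.of_forall fun x hx => ?_)
        rw [uIoc_of_le zero_le_one] at hx
        rw [hS _ (mul_pos ht hx.1), mul_pow, hscale]
        ring
    _ = (m + 1) * ∫ y in Ioi (0 : ℝ), (∫ v in (0 : ℝ)..y, h (t ^ 2 * v) / v) *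
            (Iic 1).indicator (fun y : ℝ => (1 - y) ^ m) y := by
        rw [integral_zero_one_comp_sq fun y => (m + 1) * ((∫ v in (0 : ℝ)..y, h (t ^ 2 * v) / v) *
            (1 - y) ^ m), intervalIntegral.integral_const_mul,
          intervalIntegral.integral_of_le zero_le_one, ← Ioi_inter_Iic,
          ← setIntegral_indicator measurableSet_Iic]
        simp only [indicator_mul_right]
    _ = _ := by
        rw [key, intervalIntegral.integral_of_le zero_le_one, ← Ioi_inter_Iic,
          ← setIntegral_indicator measurableSet_Iic, ← integral_const_mul]
        refine setIntegral_congr_fun measurableSet_Ioi fun v _ => ?_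
        simp only [setIntegral_indicator measurableSet_Iic, Ioi_inter_Iic]
        by_cases hv : v ≤ 1
        · rw [← intervalIntegral.integral_of_le hv, integral_one_sub_pow,
            indicator_of_mem (mem_Iic.2 hv)]
          field_simp
        · simp [hv, Ioc_eq_empty_of_le (not_le.1 hv).le]

theorem integral_div_id_bounds {h : ℝ → ℝ} (hmono : MonotoneOn h (Ici 0)) {a b : ℝ}
    (ha : 0 < a) (hab : a ≤ b) (hint : IntervalIntegrable (fun v => h v / v) volume a b) :
    h a * (Real.log b - Real.log a) ≤ ∫ v in a..b, h v / v ∧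
      ∫ v in a..b, h v / v ≤ h b * (Real.log b - Real.log a) := by
  have hb : 0 < b := ha.trans_le hab
  have hz : (0 : ℝ) ∉ uIcc a b := notMem_uIcc_of_lt ha hb
  have hi : ∀ c : ℝ, IntervalIntegrable (fun v : ℝ => c * v⁻¹) volume a b := fun c =>
    (intervalIntegrable_inv_iff.2 (Or.inr hz)).const_mul c
  have e : ∀ c : ℝ, ∫ v in a..b, c * v⁻¹ = c * (Real.log b - Real.log a) := fun c => by
    rw [intervalIntegral.integral_const_mul, integral_inv hz, Real.log_div hb.ne' ha.ne']
  rw [← e, ← e]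
  constructor
  · refine intervalIntegral.integral_mono_on hab (hi _) hint fun x hx => ?_
    have hx0 := ha.trans_le hx.1
    rw [div_eq_mul_inv]
    exact mul_le_mul_of_nonneg_right (hmono ha.le hx0.le hx.1) (inv_nonneg.2 hx0.le)
  · refine intervalIntegral.integral_mono_on hab hint (hi _) fun x hx => ?_
    have hx0 := ha.trans_le hx.1
    rw [div_eq_mul_inv]
    exact mul_le_mul_of_nonneg_right (hmono hx0.le hb.le hx.2) (inv_nonneg.2 hx0.le)

theorem convexOn_integral_div_id_exp {h : ℝ → ℝ} (hmono : MonotoneOn h (Ici 0))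
    (hint : ∀ u, 0 < u → IntervalIntegrable (fun v => h v / v) volume 0 u) :
    ConvexOn ℝ univ fun x => ∫ v in (0 : ℝ)..Real.exp x ^ 2, h v / v := by
  have hpos : ∀ x : ℝ, 0 < Real.exp x ^ 2 := fun x => by positivity
  have hlog : ∀ x, Real.log (Real.exp x ^ 2) = 2 * x := fun x => by simp
  have hi : ∀ x y, IntervalIntegrable (fun v => h v / v) volume (Real.exp x ^ 2) (Real.exp y ^ 2) :=
    fun x y => (hint _ (hpos x)).symm.trans (hint _ (hpos y))
  have hsub : ∀ x y, (∫ v in (0 : ℝ)..Real.exp y ^ 2, h v / v) -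
      (∫ v in (0 : ℝ)..Real.exp x ^ 2, h v / v) =
        ∫ v in Real.exp x ^ 2..Real.exp y ^ 2, h v / v := fun x y =>
    intervalIntegral.integral_interval_sub_left (hint _ (hpos y)) (hint _ (hpos x))
  have hle : ∀ x y, x ≤ y → Real.exp x ^ 2 ≤ Real.exp y ^ 2 := fun x y hxy => by gcongr
  refine convexOn_of_slope_mono_adjacent convex_univ fun {x y z} _ _ hxy hyz => ?_
  rw [hsub, hsub]
  have h1 := (integral_div_id_bounds hmono (hpos x) (hle _ _ hxy.le) (hi x y)).2
  have h2 := (integral_div_id_bounds hmono (hpos y) (hle _ _ hyz.le) (hi y z)).1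
  rw [hlog, hlog] at h1 h2
  calc _ ≤ 2 * h (Real.exp y ^ 2) := by
        rw [div_le_iff₀ (sub_pos.2 hxy)]; linarith
    _ ≤ _ := by
        rw [le_div_iff₀ (sub_pos.2 hyz)]; linarith

theorem exists_le_mul_rpow_of_integral_le {S : ℝ → ℝ} (hmono : MonotoneOn S (Ici 0))
    (hnn : ∀ x ∈ Ici (0 : ℝ), 0 ≤ S x) (m : ℕ) {lam : ℝ}
    (hb : ∀ t : ℝ, 0 ≤ t → ∫ x in (0 : ℝ)..1, S (t * x) * (1 - x ^ 2) ^ m * x ≤ t ^ lam) :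
    ∃ C : ℝ, ∀ t, 0 ≤ t → S t ≤ C * t ^ lam := by
  set c := ∫ x in (1 / 2 : ℝ)..1, (1 - x ^ 2) ^ m * x with hc
  have hwi : ∀ a b : ℝ, IntervalIntegrable (fun x : ℝ => (1 - x ^ 2) ^ m * x) volume a b :=
    fun a b => Continuous.intervalIntegrable (by fun_prop) _ _
  have hc0 : 0 < c := by
    refine intervalIntegral.intervalIntegral_pos_of_pos_on (hwi _ _) (fun x hx => ?_) (by norm_num)
    have : 0 < x := by linarith [hx.1]
    have : 0 < 1 - x ^ 2 := by nlinarith [hx.2]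
    positivity
  refine ⟨c⁻¹ * 2 ^ lam, fun t ht => ?_⟩
  have h2t : (0 : ℝ) ≤ 2 * t := by positivity
  have hw0 : ∀ x ∈ Icc (0 : ℝ) 1, 0 ≤ (1 - x ^ 2) ^ m * x := fun x hx =>
    mul_nonneg (pow_nonneg (by nlinarith [hx.1, hx.2]) _) hx.1
  have hSi : IntervalIntegrable (fun x => S (2 * t * x) * (1 - x ^ 2) ^ m * x) volume 0 1 := by
    have : MonotoneOn (fun x => S (2 * t * x)) (uIcc 0 1) := by
      rw [uIcc_of_le zero_le_one]
      exact fun x hx y hy hxy => hmono (mul_nonneg h2t hx.1) (mul_nonneg h2t hy.1) (by gcongr)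
    have := (this.intervalIntegrable (μ := volume)).mul_continuousOn (g := fun x : ℝ => (1 - x ^ 2) ^ m * x)
      (by fun_prop)
    simpa only [mul_assoc] using this
  have h1 : S t * c ≤ (2 * t) ^ lam := by
    calc S t * c = ∫ x in (1 / 2 : ℝ)..1, S t * ((1 - x ^ 2) ^ m * x) := by
          rw [intervalIntegral.integral_const_mul]
      _ ≤ ∫ x in (1 / 2 : ℝ)..1, S (2 * t * x) * (1 - x ^ 2) ^ m * x := by
          refine intervalIntegral.integral_mono_on (by norm_num) ((hwi _ _).const_mul _)
            (hSi.mono_set ?_) fun x hx => ?_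
          · rw [uIcc_of_le (by norm_num), uIcc_of_le zero_le_one]
            exact Icc_subset_Icc (by norm_num) le_rfl
          · have hx0 : (0 : ℝ) ≤ x := by linarith [hx.1]
            rw [mul_assoc (S _)]
            exact mul_le_mul_of_nonneg_right (hmono ht (mul_nonneg h2t hx0) (by nlinarith [hx.1]))
              (hw0 x ⟨hx0, hx.2⟩)
      _ ≤ ∫ x in (0 : ℝ)..1, S (2 * t * x) * (1 - x ^ 2) ^ m * x := by
          refine intervalIntegral.integral_mono_interval (by norm_num) (by norm_num) le_rfl ?_ hSi
          refine (ae_restrict_mem measurableSet_Ioc).mono fun x hx => ?_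
          simp only [Pi.zero_apply, mul_assoc (S _)]
          exact mul_nonneg (hnn _ (mul_nonneg h2t hx.1.le)) (hw0 x (Ioc_subset_Icc_self hx))
      _ ≤ _ := hb _ h2t
  rw [Real.mul_rpow zero_le_two ht] at h1
  rw [mul_assoc, inv_mul_eq_div, le_div_iff₀ hc0]
  exact h1

theorem exists_primitive_of_convexOn_exp {S : ℝ → ℝ} (hmono : MonotoneOn S (Ici 0))
    (hnn : ∀ x ∈ Ici (0 : ℝ), 0 ≤ S x) (hconv : ConvexOn ℝ univ fun x => S (Real.exp x))
    {C lam : ℝ} (hlam : 0 < lam) (hC : ∀ t, 0 ≤ t → S t ≤ C * t ^ lam) {k : ℝ} (hk : 0 < k) :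
    ∃ h : ℝ → ℝ, MonotoneOn h (Ici 0) ∧ (∀ x ∈ Ici (0 : ℝ), 0 ≤ h x) ∧ h 0 = 0 ∧
      (∀ u, 0 < u → IntervalIntegrable (fun v => h v / v) volume 0 u) ∧
      ∀ t, 0 < t → S t = k * ∫ v in (0 : ℝ)..t ^ 2, h v / v := by
  set g : ℝ → ℝ := fun x => S (Real.exp x) with hg
  set D : ℝ → ℝ := fun x => derivWithin g (Ioi x) x with hD
  have hS0 : S 0 = 0 := by
    refine le_antisymm ?_ (hnn 0 self_mem_Ici)
    simpa [Real.zero_rpow hlam.ne'] using hC 0 le_rfl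
  have hgm : Monotone g := fun x y hxy =>
    hmono (Real.exp_pos x).le (Real.exp_pos y).le (Real.exp_le_exp.2 hxy)
  have hDm : Monotone D := by
    have := hconv.monotoneOn_rightDeriv
    rwa [interior_univ, monotoneOn_univ] at this
  have hDd : ∀ x, HasDerivWithinAt g (D x) (Ioi x) x := fun x =>
    hconv.hasDerivWithinAt_rightDeriv_of_mem_interior (by simp)
  have hD0 : ∀ x, 0 ≤ D x := fun x => (hgm.monotoneOn _).derivWithin_nonneg
  have hgc : Continuous g := by
    rw [← continuousOn_univ]; exact hconv.continuousOn isOpen_univ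
  let h : ℝ → ℝ := fun u => if u ≤ 0 then 0 else D (Real.log u / 2) / (2 * k)
  have hh0 : ∀ u, 0 ≤ h u := fun u => by
    simp only [h]; split_ifs
    · exact le_rfl
    · exact div_nonneg (hD0 _) (by positivity)
  have hTg : ∀ u, 0 < u → S (√u) = g (Real.log u / 2) := fun u hu => by
    simp only [hg]; rw [← Real.log_sqrt hu.le, Real.exp_log (Real.sqrt_pos.2 hu)]
  have hTd : ∀ u, 0 < u → HasDerivWithinAt (fun u => S (√u)) (k * (h u / u)) (Ioi u) u := by
    intro u hu
    have h1 : HasDerivWithinAt (fun u => Real.log u / 2) (u⁻¹ / 2) (Ioi u) u :=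
      ((Real.hasDerivAt_log hu.ne').div_const 2).hasDerivWithinAt
    have h2 := (hDd (Real.log u / 2)).comp u h1 fun y hy =>
      div_lt_div_of_pos_right (Real.log_lt_log hu hy) two_pos
    have h3 : k * (h u / u) = D (Real.log u / 2) * (u⁻¹ / 2) := by
      simp only [h, if_neg (not_le.2 hu)]; field_simp
    rw [h3]
    exact h2.congr (fun y hy => hTg y (hu.trans hy)) (hTg u hu)
  have hTc : ∀ b, ContinuousOn (fun u => S (√u)) (Icc 0 b) := by
    intro b u hu
    rcases hu.1.eq_or_lt with rfl | hu0
    · have h1 : Tendsto (fun u : ℝ => C * √u ^ lam) (𝓝[Icc 0 b] 0) (𝓝 0) := by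
        have : Continuous fun u : ℝ => C * √u ^ lam :=
          ((Real.continuous_rpow_const hlam.le).comp Real.continuous_sqrt).const_mul C
        have := this.tendsto 0
        simp only [Real.sqrt_zero, Real.zero_rpow hlam.ne', mul_zero] at this
        exact this.mono_left nhdsWithin_le_nhds
      rw [ContinuousWithinAt, Real.sqrt_zero, hS0]
      exact squeeze_zero (fun u => hnn _ (Real.sqrt_nonneg u)) (fun u => hC _ (Real.sqrt_nonneg u)) h1
    · have h1 : ContinuousAt (fun u => g (Real.log u / 2)) u :=
        hgc.continuousAt.comp ((Real.continuousAt_log hu0.ne').div_const 2)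
      refine (h1.congr ?_).continuousWithinAt
      filter_upwards [lt_mem_nhds hu0] with y hy using (hTg y hy).symm
  have hint : ∀ u, 0 < u → IntervalIntegrable (fun v => k * (h v / v)) volume 0 u := by
    intro u hu
    rw [intervalIntegrable_iff_integrableOn_Ioc_of_le hu.le]
    exact intervalIntegral.integrableOn_deriv_right_of_nonneg (hTc u) (fun x hx => hTd x hx.1)
      fun x hx => mul_nonneg hk.le (div_nonneg (hh0 x) hx.1.le)
  refine ⟨h, ?_, fun x _ => hh0 x, by simp [h], fun u hu => ?_, fun t ht => ?_⟩
  · intro x _ y _ hxy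
    rcases le_or_gt x 0 with hx | hx
    · simpa only [h, if_pos hx] using hh0 y
    · have hy := hx.trans_le hxy
      simp only [h, if_neg (not_le.2 hx), if_neg (not_le.2 hy)]
      have := hDm (div_le_div_of_nonneg_right (Real.log_le_log hx hxy) zero_le_two)
      gcongr
  · simpa [hk.ne'] using (hint u hu).const_mul k⁻¹
  · rw [← intervalIntegral.integral_const_mul,
      intervalIntegral.integral_eq_sub_of_hasDeriv_right_of_le (by positivity) (hTc (t ^ 2))
        (fun x hx => hTd x hx.1) (hint _ (by positivity))]
    simp [hS0, Real.sqrt_sq ht.le]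

theorem stmt_16 (n : ℕ) (hn : 2 ≤ n) (lam : ℝ) (hlam : 1/2 ≤ lam)
    (α : ℝ) (hα : α = lam / 2) :
    -- (A) Conjecture 1 for these parameters
    ((∀ S : ℝ → ℝ, MonotoneOn S (Set.Ici 0) → (∀ x ∈ Set.Ici (0:ℝ), 0 ≤ S x) →
        ConvexOn ℝ Set.univ (fun x => S (Real.exp x)) →
        (∀ t : ℝ, 0 ≤ t →
          ∫ x in (0:ℝ)..1, S (t * x) * (1 - x^2)^(n-2) * x ≤ t ^ lam) →
        ∫ t in Set.Ioi (0:ℝ), S t * t ^ (2*lam - 1) / (1 + t ^ (2*lam))^2 ≤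
          (Real.pi * ((n:ℝ) - 1) / (2*lam)) *
            ∏ k ∈ Finset.Icc 1 (n-1), (1 + lam / (2*(k:ℝ)))) ↔
    -- (B) Conjecture 2 for α = λ/2
      (∀ h : ℝ → ℝ, MonotoneOn h (Set.Ici 0) → (∀ x ∈ Set.Ici (0:ℝ), 0 ≤ h x) →
        (∀ t : ℝ, 0 ≤ t →
          ∫ x in (0:ℝ)..1, (h (t * x) / x) * (1 - x)^(n-1) ≤ t ^ α) →
        ∫ t in Set.Ioi (0:ℝ), h t / (t * (1 + t ^ (2*α))) ≤
          (Real.pi / 2) * ∏ k ∈ Finset.Icc 1 (n-1), (1 + α / (k:ℝ)))) := by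
  obtain ⟨m, rfl⟩ : ∃ m, n = m + 2 := ⟨n - 2, by omega⟩
  have hl : 0 < lam := by linarith
  have h2α : 2 * α = lam := by linarith
  have hα0 : 0 < α := by linarith
  have hprod : ∀ k : ℕ, 1 + lam / (2 * (k : ℝ)) = 1 + α / k := fun k => by
    rw [hα, div_div]
  have hcast : ((m + 2 : ℕ) : ℝ) - 1 = m + 1 := by push_cast; ring
  have hrpow : ∀ t : ℝ, 0 ≤ t → (t ^ 2) ^ α = t ^ lam := fun t ht => by
    rw [← h2α, ← Real.rpow_natCast, ← Real.rpow_mul ht]; norm_num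
  simp only [Nat.add_sub_cancel, show m + 2 - 1 = m + 1 from rfl, hprod, hcast, h2α]
  set P := ∏ k ∈ Finset.Icc 1 (m + 1), (1 + α / (k : ℝ)) with hP
  have hP0 : 0 ≤ P := Finset.prod_nonneg fun k _ => by positivity
  have hconst : Real.pi * ((m : ℝ) + 1) / (2 * lam) * P = (m + 1) / lam * (Real.pi / 2 * P) := by
    field_simp
  have hfac : 0 < ((m : ℝ) + 1) / lam := by positivity
  rw [hconst]
  constructor
  · intro A h hmono hnn hb
    by_cases hi : IntegrableOn (fun t => h t / (t * (1 + t ^ lam))) (Ioi 0)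
    swap
    · rw [integral_undef hi]; positivity
    have hint : ∀ u, 0 < u → IntervalIntegrable (fun v => h v / v) volume 0 u := by
      intro u hu
      rw [intervalIntegrable_iff_integrableOn_Icc_of_le hu.le, integrableOn_Icc_iff_integrableOn_Ioc,
        integrableOn_Ioc_iff_integrableOn_Ioo]
      have h1 := (hi.mono_set (Ioo_subset_Ioi_self : Ioo 0 u ⊆ Ioi 0)).continuousOn_mul_of_subset
        (g := fun t : ℝ => 1 + t ^ lam) (K := Icc 0 u)
        ((Real.continuous_rpow_const hl.le).const_add 1).continuousOn
        isCompact_Icc measurableSet_Ioo Ioo_subset_Icc_self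
      refine h1.congr_fun (fun t ht => ?_) measurableSet_Ioo
      have ht0 : 0 < t := ht.1
      have : 0 < 1 + t ^ lam := by positivity
      field_simp
    set S : ℝ → ℝ := fun t => 2 * (m + 1) * ∫ v in (0 : ℝ)..t ^ 2, h v / v with hS
    have hS0 : S 0 = 0 := by simp [hS]
    have hqi : ∀ t : ℝ, IntervalIntegrable (fun v => h v / v) volume 0 (t ^ 2) := fun t => by
      rcases (sq_nonneg t).eq_or_lt with h0 | h0
      · rw [← h0]
      · exact hint _ h0
    have hSm : MonotoneOn S (Ici 0) := fun x hx y hy hxy => by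
      have hx0 : 0 ≤ x := hx
      refine mul_le_mul_of_nonneg_left ?_ (by positivity)
      refine intervalIntegral.integral_mono_interval le_rfl (sq_nonneg x) (by gcongr) ?_ (hqi y)
      exact (ae_restrict_mem measurableSet_Ioc).mono fun v hv => div_nonneg (hnn v hv.1.le) hv.1.le
    have := A S hSm (fun x hx => hS0 ▸ hSm self_mem_Ici hx hx)
      ((convexOn_integral_div_id_exp hmono hint).smul (by positivity)) fun t ht => by
        rcases ht.eq_or_lt with rfl | ht0
        · simp [hS0, Real.zero_rpow hl.ne']
        · rw [integral_zero_one_eq_of_eq_primitive hmono hnn m hint (fun _ _ => rfl) ht0,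
            ← hrpow t ht]
          exact hb _ (sq_nonneg t)
    rwa [setIntegral_Ioi_eq_of_eq_primitive hmono hnn m hl hint (fun _ _ => rfl),
      mul_le_mul_iff_right₀ hfac] at this
  · intro B S hSm hSn hconv hb
    obtain ⟨C, hC⟩ := exists_le_mul_rpow_of_integral_le hSm hSn m hb
    obtain ⟨h, hmono, hnn, h0, hint, hS⟩ := exists_primitive_of_convexOn_exp hSm hSn hconv hl hC
      (k := 2 * (m + 1)) (by positivity)
    rw [setIntegral_Ioi_eq_of_eq_primitive hmono hnn m hl hint hS, mul_le_mul_iff_right₀ hfac]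
    refine B h hmono hnn fun t ht => ?_
    rcases ht.eq_or_lt with rfl | ht0
    · simp [h0, Real.zero_rpow hα0.ne']
    · have hs := Real.sqrt_pos.2 ht0
      have := hb _ hs.le
      rwa [integral_zero_one_eq_of_eq_primitive hmono hnn m hint hS hs, ← hrpow _ hs.le,
        Real.sq_sqrt ht] at this
end
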